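/- Let G be a finite group with a minimal normal subgroup M such that G/M ≅ PSL(2,5) or PSL(2,7). Then G is not a T'_k-group for any integer k ≥ 1. -/

import Mathlib

open CategoryTheory

def Irr (G : Type) [Group G] [Fintype G] : Set (G → ℂ) :=
  {χ | ∃ V : FDRep ℂ G, Simple V ∧ χ = V.character}

noncomputable def charDeg (G : Type) [Group G] (χ : G → ℂ) : ℕ := Nat.floor (χ 1).re

def kerSet (G : Type) [Group G] (χ : G → ℂ) : Set G := {g | χ g = χ 1}

noncomputable def cod (G : Type) [Group G] [Fintype G] (χ : G → ℂ) : ℕ :=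
  Fintype.card G / (kerSet G χ).ncard / charDeg G χ

def codSet (G : Type) [Group G] [Fintype G] : Set ℕ := {d | ∃ χ ∈ Irr G, cod G χ = d}

noncomputable def codMult (G : Type) [Group G] [Fintype G] (d : ℕ) : ℕ :=
  {χ ∈ Irr G | cod G χ = d}.ncard

def IsTk' (G : Type) [Group G] [Fintype G] (k : ℕ) : Prop :=
  ∃ d₀ ∈ codSet G, codMult G d₀ = k ∧ ∀ d ∈ codSet G, d ≠ d₀ → codMult G d = 1

abbrev PSL2 (n : ℕ) : Type :=
  Matrix.SpecialLinearGroup (Fin 2) (ZMod n) ⧸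
    Subgroup.center (Matrix.SpecialLinearGroup (Fin 2) (ZMod n))

namespace Codegree

section Basic

variable {G : Type} [Group G]

/-- A function on `G` afforded by a finite-dimensional complex representation. -/
def IsChar (χ : G → ℂ) : Prop := ∃ V : FDRep ℂ G, χ = V.character

lemma isChar_of_representation {V : Type} [AddCommGroup V] [Module ℂ V] [FiniteDimensional ℂ V]
    (ρ : Representation ℂ G V) : IsChar ρ.character :=
  ⟨FDRep.of ρ, rfl⟩

lemma IsChar.exists_representation {χ : G → ℂ} (h : IsChar χ) :
    ∃ (n : ℕ) (ρ : Representation ℂ G (Fin n → ℂ)), χ = ρ.character := by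
  obtain ⟨V, rfl⟩ := h
  let e := (Module.finBasis ℂ V).equivFun
  refine ⟨_, (LinearEquiv.conjRingEquiv e).toMonoidHom.comp V.ρ, ?_⟩
  ext g
  exact (LinearMap.trace_conj' (V.ρ g) e).symm

lemma IsChar.comp {H : Type} [Group H] {χ : G → ℂ} (h : IsChar χ) (f : H →* G) :
    IsChar (fun x => χ (f x)) := by
  obtain ⟨n, ρ, rfl⟩ := h.exists_representation
  exact isChar_of_representation (ρ.comp f)

lemma IsChar.mul {χ φ : G → ℂ} (h : IsChar χ) (h' : IsChar φ) : IsChar (χ * φ) := by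
  obtain ⟨V, rfl⟩ := h
  obtain ⟨W, rfl⟩ := h'
  exact ⟨MonoidalCategory.tensorObj V W, (FDRep.char_tensor V W).symm⟩

lemma isChar_one : IsChar (1 : G → ℂ) := by
  refine ⟨FDRep.of (Representation.trivial ℂ G ℂ), ?_⟩
  ext g
  have h : LinearMap.trace ℂ ℂ 1 = 1 := by simp
  exact h.symm

/-- Applying a ring endomorphism of `ℂ` to the entries of a matrix representation. -/
lemma IsChar.map {χ : G → ℂ} (h : IsChar χ) (σ : ℂ →+* ℂ) : IsChar (fun x => σ (χ x)) := by
  obtain ⟨n, ρ, rfl⟩ := h.exists_representation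
  let f : G →* Module.End ℂ (Fin n → ℂ) :=
    (Matrix.toLinAlgEquiv' : Matrix (Fin n) (Fin n) ℂ ≃ₐ[ℂ] _).toMonoidHom.comp
      ((σ.mapMatrix : Matrix (Fin n) (Fin n) ℂ →+* _).toMonoidHom.comp
        ((LinearMap.toMatrixAlgEquiv' : _ ≃ₐ[ℂ] Matrix (Fin n) (Fin n) ℂ).toMonoidHom.comp ρ))
  have hf : (fun x => σ (ρ.character x)) = Representation.character (V := Fin n → ℂ) f := by
    ext g
    change σ (LinearMap.trace ℂ _ (ρ g)) = LinearMap.trace ℂ _ (Matrix.toLin' (σ.mapMatrix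
      (LinearMap.toMatrix' (ρ g))))
    rw [Matrix.trace_toLin'_eq, LinearMap.trace_eq_matrix_trace ℂ (Pi.basisFun ℂ (Fin n))]
    simp [Matrix.trace, LinearMap.toMatrix_eq_toMatrix']
  rw [hf]
  exact isChar_of_representation _

lemma IsChar.conj {χ : G → ℂ} (h : IsChar χ) (x y : G) : χ (y * x * y⁻¹) = χ x := by
  obtain ⟨V, rfl⟩ := h
  exact V.char_conj x y

lemma IsChar.apply_one {χ : G → ℂ} (h : IsChar χ) : ∃ n : ℕ, χ 1 = n := by
  obtain ⟨V, rfl⟩ := h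
  exact ⟨_, V.char_one⟩

lemma IsChar.charDeg_eq {χ : G → ℂ} (h : IsChar χ) : (charDeg G χ : ℂ) = χ 1 := by
  obtain ⟨n, hn⟩ := h.apply_one
  simp [charDeg, hn]

end Basic

section Inner

variable {G : Type} [Group G] [Fintype G]

/-- The bilinear form `|G|⁻¹ ∑ f₁(x) f₂(x⁻¹)` on functions on a finite group. -/
noncomputable def charInner (f₁ f₂ : G → ℂ) : ℂ := (Nat.card G : ℂ)⁻¹ * ∑ x, f₁ x * f₂ x⁻¹

lemma card_ne_zero : (Nat.card G : ℂ) ≠ 0 := by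
  exact_mod_cast Nat.card_pos.ne'

lemma charInner_comm (f₁ f₂ : G → ℂ) : charInner f₁ f₂ = charInner f₂ f₁ := by
  unfold charInner
  congr 1
  refine Fintype.sum_equiv (Equiv.inv G) _ _ fun x => ?_
  simp [mul_comm]

lemma charInner_sum_left {ι : Type*} (s : Finset ι) (f : ι → G → ℂ) (c : ι → ℂ) (φ : G → ℂ) :
    charInner (∑ i ∈ s, c i • f i) φ = ∑ i ∈ s, c i * charInner (f i) φ := by
  simp only [charInner, Finset.sum_apply, Pi.smul_apply, smul_eq_mul, Finset.sum_mul,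
    Finset.mul_sum]
  rw [Finset.sum_comm]
  refine Finset.sum_congr rfl fun i _ => Finset.sum_congr rfl fun x _ => by ring

lemma charInner_sub_left (f₁ f₂ φ : G → ℂ) :
    charInner (f₁ - f₂) φ = charInner f₁ φ - charInner f₂ φ := by
  simp [charInner, sub_mul, mul_sub]

lemma mem_Irr_iff {χ : G → ℂ} : χ ∈ Irr G ↔ IsChar χ ∧ charInner χ χ = 1 := by
  have key (V : FDRep ℂ G) : Simple V ↔ charInner V.character V.character = 1 := by
    rw [FDRep.simple_iff_char_is_norm_one, charInner, inv_mul_eq_one₀ card_ne_zero, eq_comm]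
  constructor
  · rintro ⟨V, hV, rfl⟩
    exact ⟨⟨V, rfl⟩, (key V).1 hV⟩
  · rintro ⟨⟨V, rfl⟩, h⟩
    exact ⟨V, (key V).2 h, rfl⟩

lemma isChar_of_mem_Irr {χ : G → ℂ} (h : χ ∈ Irr G) : IsChar χ := (mem_Irr_iff.1 h).1

lemma charInner_self {χ : G → ℂ} (h : χ ∈ Irr G) : charInner χ χ = 1 := (mem_Irr_iff.1 h).2

lemma charInner_eq_zero {χ φ : G → ℂ} (h : χ ∈ Irr G) (h' : φ ∈ Irr G) (hne : χ ≠ φ) :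
    charInner χ φ = 0 := by
  obtain ⟨V, hV, rfl⟩ := h
  obtain ⟨W, hW, rfl⟩ := h'
  have := invertibleOfNonzero (card_ne_zero (G := G))
  have := FDRep.char_orthonormal V W
  rw [if_neg (fun ⟨i⟩ => hne (FDRep.char_iso i))] at this
  exact this

lemma IsChar.exists_charInner_eq {χ φ : G → ℂ} (h : IsChar χ) (h' : IsChar φ) :
    ∃ n : ℕ, charInner χ φ = n := by
  obtain ⟨V, rfl⟩ := h
  obtain ⟨W, rfl⟩ := h'
  have := invertibleOfNonzero (card_ne_zero (G := G))
  exact ⟨_, FDRep.scalar_product_char_eq_finrank_equivariant W V⟩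

lemma map_mem_Irr {χ : G → ℂ} (h : χ ∈ Irr G) (σ : ℂ →+* ℂ) : (fun x => σ (χ x)) ∈ Irr G := by
  rw [mem_Irr_iff] at h ⊢
  refine ⟨h.1.map σ, ?_⟩
  have := congrArg σ h.2
  simpa [charInner] using this

lemma comp_mem_Irr {χ : G → ℂ} (h : χ ∈ Irr G) (f : G ≃* G) : (fun x => χ (f x)) ∈ Irr G := by
  rw [mem_Irr_iff] at h ⊢
  refine ⟨h.1.comp f.toMonoidHom, ?_⟩
  rw [← h.2]
  unfold charInner
  congr 1
  exact Fintype.sum_equiv f.toEquiv _ _ fun x => by simp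

lemma one_mem_Irr : (1 : G → ℂ) ∈ Irr G := by
  rw [mem_Irr_iff]
  exact ⟨isChar_one, by simp [charInner]⟩

lemma Irr_finite : (Irr G).Finite := by
  have hli : LinearIndependent ℂ (fun χ : Irr G => (χ : G → ℂ)) := by
    rw [linearIndependent_iff']
    intro s c hc χ hχ
    have h := charInner_sum_left s (fun χ : Irr G => (χ : G → ℂ)) c χ
    rw [hc, Finset.sum_eq_single χ] at h
    · rw [charInner_self χ.2, mul_one] at h
      simpa [charInner] using h.symm
    · intro φ _ hne
      rw [charInner_eq_zero φ.2 χ.2 (fun h => hne (Subtype.ext h)), mul_zero]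
    · exact fun h => absurd hχ h
  have := hli.finite
  exact Set.toFinite _

/-- The irreducible characters as a finset. -/
noncomputable def irr (G : Type) [Group G] [Fintype G] : Finset (G → ℂ) :=
  (Irr_finite (G := G)).toFinset

@[simp] lemma mem_irr {χ : G → ℂ} : χ ∈ irr G ↔ χ ∈ Irr G := by simp [irr]

end Inner

section Schur

variable {G : Type} [Group G] [Fintype G]

/-- Schur's lemma for a representation affording an irreducible character. -/
lemma exists_eq_smul_one {V : Type} [AddCommGroup V] [Module ℂ V] [FiniteDimensional ℂ V]
    {ρ : Representation ℂ G V} (h : ρ.character ∈ Irr G) (f : Module.End ℂ V)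
    (hf : ∀ x, f * ρ x = ρ x * f) : ∃ c : ℂ, f = c • 1 := by
  have := invertibleOfNonzero (card_ne_zero (G := G))
  have h1 := Representation.card_inv_mul_sum_char_mul_char_eq_finrank ρ ρ
  have h2 : Module.finrank ℂ (Representation.IntertwiningMap ρ ρ) = 1 := by
    exact_mod_cast h1.symm.trans (charInner_self h)
  let F : Representation.IntertwiningMap ρ ρ := ⟨f, fun g => hf g⟩
  by_cases h0 : Representation.IntertwiningMap.id ρ = 0
  · refine ⟨0, ?_⟩
    ext v
    have : v = 0 := by simpa using congrArg (fun a => a v) h0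
    simp [this]
  · obtain ⟨c, hc⟩ := (finrank_eq_one_iff_of_nonzero' _ h0).1 h2 F
    refine ⟨c, ?_⟩
    ext v
    exact (congrArg (fun a => a v) hc).symm

/-- For a class function `f`, the operator `∑ f(x⁻¹) ρ(x)` is a scalar for irreducible `ρ`. -/
lemma sum_smul_eq_smul_one {V : Type} [AddCommGroup V] [Module ℂ V] [FiniteDimensional ℂ V]
    {ρ : Representation ℂ G V} (h : ρ.character ∈ Irr G) {f : G → ℂ}
    (hf : ∀ x y, f (y * x * y⁻¹) = f x) :
    ∃ c : ℂ, ∑ x, f x⁻¹ • ρ x = c • 1 ∧ c * ρ.character 1 = Nat.card G * charInner f ρ.character := by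
  obtain ⟨c, hc⟩ := exists_eq_smul_one h (∑ x, f x⁻¹ • ρ x) (by
    intro y
    rw [Finset.sum_mul, Finset.mul_sum]
    refine Fintype.sum_equiv (MulAut.conj y⁻¹).toEquiv _ _ fun x => ?_
    have h1 : f (y⁻¹ * x * y)⁻¹ = f x⁻¹ := by
      have := hf x⁻¹ y⁻¹
      simpa [mul_assoc] using this
    simp only [MulEquiv.toEquiv_eq_coe, MulEquiv.coe_toEquiv, MulAut.conj_apply, inv_inv, h1,
      smul_mul_assoc, mul_smul_comm]
    rw [← map_mul, ← map_mul]
    congr 2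
    group)
  refine ⟨c, hc, ?_⟩
  have h2 := congrArg (LinearMap.trace ℂ V) hc
  rw [map_sum, map_smul] at h2
  rw [charInner_comm, charInner, mul_inv_cancel_left₀ card_ne_zero]
  simp only [map_smul, smul_eq_mul] at h2
  rw [Representation.character, map_one, ← h2]
  exact Finset.sum_congr rfl fun x _ => mul_comm _ _

open scoped MonoidAlgebra in
lemma sum_single_smul_eq_zero {f : G → ℂ} (hf : ∀ x y, f (y * x * y⁻¹) = f x)
    (h : ∀ χ ∈ Irr G, charInner f χ = 0) (S : Type) [AddCommGroup S] [Module ℂ[G] S]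
    [hS : IsSimpleModule ℂ[G] S] (v : S) :
    (∑ x, MonoidAlgebra.single x (f x⁻¹) : ℂ[G]) • v = 0 := by
  set z : ℂ[G] := ∑ x, MonoidAlgebra.single x (f x⁻¹) with hzdef
  let _ : Module ℂ S := Module.compHom S (algebraMap ℂ ℂ[G])
  have : IsScalarTower ℂ ℂ[G] S := IsScalarTower.of_algebraMap_smul fun _ _ => rfl
  have : FiniteDimensional ℂ S := Module.Finite.trans ℂ[G] _
  let ρ : Representation ℂ G S :=
    ((Algebra.lsmul ℂ ℂ S : ℂ[G] →ₐ[ℂ] _) : ℂ[G] →* _).comp (MonoidAlgebra.of ℂ G)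
  have hρz (y : ℂ[G]) : ρ.asAlgebraHom y = Algebra.lsmul ℂ ℂ S y := by
    have : ρ.asAlgebraHom = Algebra.lsmul ℂ ℂ S := by
      ext x
      simp [ρ]
    rw [this]
  have hρ : ρ.IsIrreducible := by
    rw [Representation.irreducible_iff_isSimpleModule_asModule]
    let e : ρ.asModule ≃ₗ[ℂ[G]] S :=
      { ρ.asModuleEquiv with
        map_smul' := fun r v => by
          have := ρ.asModuleEquiv_map_smul r v
          rw [hρz] at this
          exact this }
    exact IsSimpleModule.congr e
  have hirr : ρ.character ∈ Irr G := by
    have := invertibleOfNonzero (card_ne_zero (G := G))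
    refine mem_Irr_iff.2 ⟨isChar_of_representation ρ, ?_⟩
    have h1 := Representation.card_inv_mul_sum_char_mul_char_eq_finrank ρ ρ
    rw [Representation.IsIrreducible.finrank_intertwiningMap_self] at h1
    exact_mod_cast h1
  obtain ⟨c, hc, hc'⟩ := sum_smul_eq_smul_one hirr hf
  rw [h _ hirr, mul_zero, Representation.char_one, mul_eq_zero, Nat.cast_eq_zero] at hc'
  have hop : ∑ x, f x⁻¹ • ρ x = 0 := by
    rcases hc' with h0 | h0
    · rw [hc, h0, zero_smul]
    · have := Module.finrank_zero_iff.1 h0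
      exact Subsingleton.elim _ _
  have hz' : ρ.asAlgebraHom z = 0 := by
    rw [← hop, map_sum]
    exact Finset.sum_congr rfl fun x _ => by rw [Representation.asAlgebraHom_single]
  rw [hρz] at hz'
  exact LinearMap.congr_fun hz' v

open scoped MonoidAlgebra in
/-- A class function orthogonal to all irreducible characters vanishes. -/
lemma eq_zero_of_charInner_eq_zero {f : G → ℂ} (hf : ∀ x y, f (y * x * y⁻¹) = f x)
    (h : ∀ χ ∈ Irr G, charInner f χ = 0) : f = 0 := by
  classical
  let z : ℂ[G] := ∑ x, MonoidAlgebra.single x (f x⁻¹)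
  have hz : z = 0 := by
    have hJ : Ring.jacobson ℂ[G] = ⊥ := IsSemisimpleModule.jacobson_eq_bot ℂ[G] ℂ[G]
    rw [← Ideal.mem_bot (R := ℂ[G]), ← hJ, Ring.jacobson_eq_sInf_isMaximal, Submodule.mem_sInf]
    intro I hI
    have hS : IsSimpleModule ℂ[G] (ℂ[G] ⧸ I) :=
      isSimpleModule_iff_isCoatom.2 (Ideal.isMaximal_def.1 hI)
    have h3 := sum_single_smul_eq_zero hf h (ℂ[G] ⧸ I) (Submodule.Quotient.mk 1)
    rw [← Submodule.Quotient.mk_smul, Submodule.Quotient.mk_eq_zero] at h3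
    simpa using h3
  ext x
  have := congrArg (fun a : ℂ[G] => a.coeff x⁻¹) hz
  simpa [z, MonoidAlgebra.coeff_sum, Finsupp.finsetSum_apply, Finsupp.single_apply] using this

/-- Fourier expansion of a class function. -/
lemma eq_sum_irr {f : G → ℂ} (hf : ∀ x y, f (y * x * y⁻¹) = f x) :
    f = ∑ χ ∈ irr G, charInner f χ • χ := by
  classical
  rw [← sub_eq_zero]
  refine eq_zero_of_charInner_eq_zero (fun x y => ?_) fun φ hφ => ?_
  · simp only [Pi.sub_apply, hf, Finset.sum_apply, Pi.smul_apply]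
    congr 1
    exact Finset.sum_congr rfl fun χ hχ => by rw [(isChar_of_mem_Irr (mem_irr.1 hχ)).conj]
  · rw [charInner_sub_left, charInner_sum_left, Finset.sum_eq_single φ, charInner_self hφ]
    · ring
    · intro χ hχ hne
      rw [charInner_eq_zero (mem_irr.1 hχ) hφ hne, mul_zero]
    · exact fun h => absurd (mem_irr.2 hφ) h

end Schur
section Spectral

variable {V : Type} [AddCommGroup V] [Module ℂ V]

lemma pow_apply_eigenvector {A : Module.End ℂ V} {v : V} {μ : ℂ} (h : A v = μ • v) (j : ℕ) :
    (A ^ j) v = μ ^ j • v := by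
  induction j with
  | zero => simp
  | succ j ih => rw [pow_succ, Module.End.mul_apply, h, map_smul, ih, smul_smul, pow_succ']

lemma trace_eq_sum {ι : Type} [Fintype ι] (b : Module.Basis ι ℂ V) {μ : ι → ℂ}
    {A : Module.End ℂ V} (h : ∀ i, A (b i) = μ i • b i) : LinearMap.trace ℂ V A = ∑ i, μ i := by
  classical
  rw [LinearMap.trace_eq_matrix_trace ℂ b, Matrix.trace]
  refine Finset.sum_congr rfl fun i _ => ?_
  simp [LinearMap.toMatrix_apply, h]

variable [FiniteDimensional ℂ V]

/-- An operator of finite order is diagonalizable. -/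
lemma exists_eigenbasis {A : Module.End ℂ V} {N : ℕ} (hN : N ≠ 0) (hA : A ^ N = 1) :
    ∃ (ι : Type) (_ : Fintype ι) (b : Module.Basis ι ℂ V) (μ : ι → ℂ),
      (∀ i, A (b i) = μ i • b i) ∧ ∀ i, μ i ^ N = 1 := by
  classical
  have hss : A.IsSemisimple := by
    refine Module.End.isSemisimple_of_squarefree_aeval_eq_zero
      (Polynomial.X_pow_sub_one_separable_iff.2 (Nat.cast_ne_zero.2 hN)).squarefree ?_
    simp [hA]
  have hint := DirectSum.isInternal_submodule_of_iSupIndep_of_iSup_eq_top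
    A.eigenspaces_iSupIndep hss.iSup_eigenspace_eq_top
  let b := hint.collectedBasis fun μ => Module.finBasis ℂ (A.eigenspace μ)
  have hfin : Finite (Σ μ, Fin (Module.finrank ℂ (A.eigenspace μ))) :=
    Module.Finite.finite_basis b
  have hb i : A (b i) = i.1 • b i := Module.End.mem_eigenspace_iff.1 (hint.collectedBasis_mem _ i)
  refine ⟨_, Fintype.ofFinite _, b, fun i => i.1, hb, fun i => ?_⟩
  have h1 := pow_apply_eigenvector (hb i) N
  rw [hA, Module.End.one_apply] at h1
  have : (i.1 ^ N - 1) • b i = 0 := by rw [sub_smul, ← h1, one_smul, sub_self]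
  rcases smul_eq_zero.1 this with h2 | h2
  · exact sub_eq_zero.1 h2
  · exact absurd h2 (b.ne_zero i)

lemma eq_one_of_trace_eq {A : Module.End ℂ V} {N : ℕ} (hN : N ≠ 0) (hA : A ^ N = 1)
    (h : LinearMap.trace ℂ V A = LinearMap.trace ℂ V 1) : A = 1 := by
  obtain ⟨ι, _, b, μ, hb, hμ⟩ := exists_eigenbasis hN hA
  rw [trace_eq_sum b hb, trace_eq_sum b (μ := 1) (fun i => by simp)] at h
  have hre (i : ι) : (μ i).re ≤ 1 :=
    (Complex.re_le_norm _).trans (Complex.norm_eq_one_of_pow_eq_one (hμ i) hN).le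
  have h2 : ∑ i, (μ i).re = ∑ i : ι, (1 : ℝ) := by
    have := congrArg Complex.re h
    simpa using this
  have h3 := (Finset.sum_eq_sum_iff_of_le fun i _ => hre i).1 h2
  refine b.ext fun i => ?_
  rw [hb]
  have h4 : (μ i).re = 1 := h3 i (Finset.mem_univ i)
  have h5 : ‖μ i‖ = 1 := Complex.norm_eq_one_of_pow_eq_one (hμ i) hN
  have h6 : (μ i).im = 0 := by
    have := Complex.sq_norm (μ i)
    rw [h5, Complex.normSq_apply, h4] at this
    nlinarith
  have : μ i = 1 := Complex.ext (by simpa using h4) (by simpa using h6)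
  simp [this]

end Spectral

section Kernel

variable {G : Type} [Group G]

lemma kerSet_map (χ : G → ℂ) (σ : ℂ →+* ℂ) : kerSet G (fun x => σ (χ x)) = kerSet G χ := by
  ext x
  exact σ.injective.eq_iff

lemma IsChar.charDeg_map {χ : G → ℂ} (h : IsChar χ) (σ : ℂ →+* ℂ) :
    charDeg G (fun x => σ (χ x)) = charDeg G χ := by
  have h1 := (h.map σ).charDeg_eq
  have h2 := h.charDeg_eq
  rw [← h2, map_natCast] at h1
  exact_mod_cast h1

variable [Fintype G]

lemma rep_pow_card {V : Type} [AddCommGroup V] [Module ℂ V] (ρ : Representation ℂ G V) (x : G) :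
    ρ x ^ Fintype.card G = 1 := by
  rw [← map_pow, pow_card_eq_one, map_one]

lemma mem_kerSet_iff {V : Type} [AddCommGroup V] [Module ℂ V] [FiniteDimensional ℂ V]
    (ρ : Representation ℂ G V) (x : G) : x ∈ kerSet G ρ.character ↔ ρ x = 1 := by
  constructor
  · intro h
    refine eq_one_of_trace_eq Fintype.card_ne_zero (rep_pow_card ρ x) ?_
    have : ρ.character x = ρ.character 1 := h
    rwa [Representation.character, Representation.character, map_one] at this
  · intro h
    change ρ.character x = ρ.character 1
    rw [Representation.character, Representation.character, map_one, h]

/-- The kernel of a character, as a normal subgroup. -/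
lemma IsChar.exists_ker {χ : G → ℂ} (h : IsChar χ) :
    ∃ K : Subgroup G, K.Normal ∧ (K : Set G) = kerSet G χ := by
  obtain ⟨n, ρ, rfl⟩ := h.exists_representation
  refine ⟨MonoidHom.ker ρ, inferInstance, ?_⟩
  ext x
  rw [mem_kerSet_iff]
  exact MonoidHom.mem_ker

lemma IsChar.mul_of_mem_kerSet {χ : G → ℂ} (h : IsChar χ) {x y : G} (hy : y ∈ kerSet G χ) :
    χ (x * y) = χ x := by
  obtain ⟨n, ρ, rfl⟩ := h.exists_representation
  rw [mem_kerSet_iff] at hy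
  rw [Representation.character, map_mul, hy, mul_one, Representation.character]

lemma IsChar.isIntegral {χ : G → ℂ} (h : IsChar χ) (x : G) : IsIntegral ℤ (χ x) := by
  obtain ⟨n, ρ, rfl⟩ := h.exists_representation
  obtain ⟨ι, _, b, μ, hb, hμ⟩ := exists_eigenbasis Fintype.card_ne_zero (rep_pow_card ρ x)
  rw [Representation.character, trace_eq_sum b hb]
  refine IsIntegral.sum _ fun i _ => IsIntegral.of_pow (Fintype.card_pos (α := G)) ?_
  rw [hμ]
  exact isIntegral_one

/-- A ring endomorphism raising `r`-th roots of unity to the `j`-th power sends `χ x` to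
`χ (x ^ j)` when `x ^ r` is in the kernel of `χ`. -/
lemma IsChar.map_apply {χ : G → ℂ} (h : IsChar χ) {σ : ℂ →+* ℂ} {r j : ℕ} (hr : r ≠ 0)
    (hσ : ∀ μ : ℂ, μ ^ r = 1 → σ μ = μ ^ j) {x : G} (hx : x ^ r ∈ kerSet G χ) :
    σ (χ x) = χ (x ^ j) := by
  obtain ⟨n, ρ, rfl⟩ := h.exists_representation
  rw [mem_kerSet_iff, map_pow] at hx
  obtain ⟨ι, _, b, μ, hb, hμ⟩ := exists_eigenbasis hr hx
  rw [Representation.character, Representation.character, map_pow, trace_eq_sum b hb,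
    trace_eq_sum b (fun i => pow_apply_eigenvector (hb i) j), map_sum]
  exact Finset.sum_congr rfl fun i _ => hσ _ (hμ i)

/-- Complex conjugation sends `χ x` to `χ x⁻¹`. -/
lemma IsChar.conj_apply {χ : G → ℂ} (h : IsChar χ) (x : G) :
    (starRingEnd ℂ) (χ x) = χ x⁻¹ := by
  have h1 := h.map_apply (σ := starRingEnd ℂ) (r := Fintype.card G) (j := Fintype.card G - 1)
    Fintype.card_ne_zero (fun μ hμ => ?_) (x := x) (by simp [pow_card_eq_one, kerSet])
  · rw [h1]
    congr 1
    rw [eq_inv_iff_mul_eq_one, ← pow_succ, Nat.sub_add_cancel Fintype.card_pos, pow_card_eq_one]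
  · have hn := Complex.norm_eq_one_of_pow_eq_one hμ Fintype.card_ne_zero
    have h0 : μ ≠ 0 := by rintro rfl; simp at hn
    have h2 : μ * (starRingEnd ℂ) μ = 1 := by
      rw [Complex.mul_conj, Complex.normSq_eq_norm_sq, hn]; simp
    apply mul_left_cancel₀ h0
    rw [h2, ← pow_succ', Nat.sub_add_cancel Fintype.card_pos, hμ]

lemma IsChar.cod_map {χ : G → ℂ} (h : IsChar χ) (σ : ℂ →+* ℂ) :
    cod G (fun x => σ (χ x)) = cod G χ := by
  rw [cod, cod, kerSet_map, h.charDeg_map]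

lemma charDeg_pos {χ : G → ℂ} (h : χ ∈ Irr G) : 0 < charDeg G χ := by
  rw [Nat.pos_iff_ne_zero]
  intro h0
  have h1 := (isChar_of_mem_Irr h).charDeg_eq
  obtain ⟨n, ρ, rfl⟩ := (isChar_of_mem_Irr h).exists_representation
  have h2 := charInner_self h
  rw [h0, Nat.cast_zero, Representation.char_one, eq_comm, Nat.cast_eq_zero] at h1
  have h3 : Subsingleton (Fin n → ℂ) := Module.finrank_zero_iff.1 h1
  have h4 (x : G) : ρ.character x = 0 := by
    rw [Representation.character, Subsingleton.elim (ρ x) 0, map_zero]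
  simp [charInner, h4] at h2

lemma apply_one_ne_zero {χ : G → ℂ} (h : χ ∈ Irr G) : χ 1 ≠ 0 := by
  rw [← (isChar_of_mem_Irr h).charDeg_eq]
  exact_mod_cast (charDeg_pos h).ne'

end Kernel
section GaloisAction

/-- A ring homomorphism to an algebraically closed field extends along algebraic extensions. -/
lemma exists_ringHom_extension {P S K : Type} [CommRing P] [IsDomain P] [Field S] [Field K]
    [IsAlgClosed K] [Algebra P S] [Algebra.IsAlgebraic P S] [FaithfulSMul P S]
    (g : P →+* K) (hg : Function.Injective g) :
    ∃ h : S →+* K, ∀ p, h (algebraMap P S p) = g p := by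
  let _ := g.toAlgebra
  have : FaithfulSMul P K := (faithfulSMul_iff_algebraMap_injective P K).2 hg
  exact ⟨(IsAlgClosed.lift : S →ₐ[P] K).toRingHom, fun p => AlgHom.commutes _ p⟩

/-- An endomorphism of a subfield of `ℂ` extends to `ℂ`. -/
lemma exists_ringHom_extending {R : Type} [Field R] [Algebra R ℂ] (τ : R →+* R) :
    ∃ σ : ℂ →+* ℂ, ∀ x, σ (algebraMap R ℂ x) = algebraMap R ℂ (τ x) := by
  obtain ⟨s, hs⟩ := exists_isTranscendenceBasis R ℂ
  let v : s → ℂ := Subtype.val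
  let P := Algebra.adjoin R (Set.range v)
  have : Algebra.IsAlgebraic P ℂ := hs.isAlgebraic
  let e : MvPolynomial s R ≃ₐ[R] P := hs.1.aevalEquiv
  let g : P →+* ℂ := ((MvPolynomial.aeval v : MvPolynomial s R →ₐ[R] ℂ).toRingHom.comp
    (MvPolynomial.map τ)).comp e.symm.toAlgHom.toRingHom
  have hg : Function.Injective g :=
    (Function.Injective.comp hs.1 (MvPolynomial.map_injective τ τ.injective)).comp e.symm.injective
  obtain ⟨σ, hσ⟩ := exists_ringHom_extension (S := ℂ) g hg
  refine ⟨σ, fun x => ?_⟩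
  have h1 := hσ (algebraMap R P x)
  have h2 : g (algebraMap R P x) = algebraMap R ℂ (τ x) := by
    change MvPolynomial.aeval v (MvPolynomial.map τ (e.symm (algebraMap R P x))) = _
    rw [AlgEquiv.commutes, MvPolynomial.algebraMap_eq, MvPolynomial.map_C, MvPolynomial.aeval_C]
  rw [← h2, ← h1]
  rfl

lemma exists_galois_of_cyclotomic (R : Type) [Field R] [Algebra ℚ R] {r j : ℕ} [NeZero r]
    [IsCyclotomicExtension {r} ℚ R] (hj : j.Coprime r) :
    ∃ σ : ℂ →+* ℂ, ∀ μ : ℂ, μ ^ r = 1 → σ μ = μ ^ j := by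
  have hζ := IsCyclotomicExtension.zeta_spec r ℚ R
  have hirr : Irreducible (Polynomial.cyclotomic r ℚ) :=
    Polynomial.cyclotomic.irreducible_rat (NeZero.pos r)
  let τ := IsCyclotomicExtension.fromZetaAut (hζ.pow_of_coprime j hj) hirr
  have hτ : τ (IsCyclotomicExtension.zeta r ℚ R) = _ :=
    IsCyclotomicExtension.fromZetaAut_spec (hζ.pow_of_coprime j hj) hirr
  have : Algebra.IsAlgebraic ℚ R :=
    have := IsCyclotomicExtension.finiteDimensional {r} ℚ R
    Algebra.IsAlgebraic.of_finite ℚ R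
  let _ : Algebra R ℂ := (IsAlgClosed.lift (R := ℚ) : R →ₐ[ℚ] ℂ).toRingHom.toAlgebra
  obtain ⟨σ, hσ⟩ := exists_ringHom_extending (τ : R →+* R)
  refine ⟨σ, fun μ hμ => ?_⟩
  have hζ' := hζ.map_of_injective (algebraMap R ℂ).injective
  obtain ⟨i, -, rfl⟩ := hζ'.eq_pow_of_pow_eq_one hμ
  rw [map_pow, hσ]
  have : (τ : R →+* R) (IsCyclotomicExtension.zeta r ℚ R) = _ := hτ
  rw [this, map_pow, ← pow_mul, ← pow_mul, mul_comm]

/-- There is an endomorphism of `ℂ` raising the `r`-th roots of unity to the `j`-th power. -/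
lemma exists_galois {r j : ℕ} [NeZero r] (hj : j.Coprime r) :
    ∃ σ : ℂ →+* ℂ, ∀ μ : ℂ, μ ^ r = 1 → σ μ = μ ^ j :=
  have : NeZero (r : ℚ) := ⟨Nat.cast_ne_zero.2 (NeZero.ne r)⟩
  @exists_galois_of_cyclotomic (CyclotomicField r ℚ) _ _ r j _
    (CyclotomicField.isCyclotomicExtension r ℚ) hj

end GaloisAction

section DegreeBound

variable {G : Type} [Group G] [Fintype G]

/-- If the image of `x` has prime order `r` and is conjugate to its `k`-th power, its spectrum
is stable under powers. -/
lemma IsChar.le_charDeg {χ : G → ℂ} (h : IsChar χ) {r k k' s : ℕ} (hr : r.Prime)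
    (hk : k * k' % r = 1) (hinj : ∀ i j : Fin s, k' ^ (i : ℕ) ≡ k' ^ (j : ℕ) [MOD r] → i = j)
    {x y : G} (hx : x ^ r ∈ kerSet G χ) (hx1 : x ∉ kerSet G χ)
    (hy : (y * x * y⁻¹)⁻¹ * x ^ k ∈ kerSet G χ) : s ≤ charDeg G χ := by
  have hdeg := h.charDeg_eq
  obtain ⟨n, ρ, rfl⟩ := h.exists_representation
  rw [Representation.char_one, Nat.cast_inj] at hdeg
  rw [hdeg]
  rw [mem_kerSet_iff] at hx hx1 hy
  set A : Module.End ℂ (Fin n → ℂ) := ρ x with hA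
  have hAr : A ^ r = 1 := by rw [← hx, map_pow]
  obtain ⟨ι, _, b, μ, hb, hμ⟩ := exists_eigenbasis hr.ne_zero hAr
  obtain ⟨i₀, hi₀⟩ : ∃ i, μ i ≠ 1 := by
    by_contra! hall
    exact hx1 (b.ext fun i => by rw [hb, hall]; simp)
  have hord : orderOf (μ i₀) = r := by
    have := Fact.mk hr
    exact orderOf_eq_prime (hμ i₀) hi₀
  have hprim : IsPrimitiveRoot (μ i₀) r := by rw [← hord]; exact IsPrimitiveRoot.orderOf _
  have hconj : A ^ k * ρ y = ρ y * A := by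
    have h1 : ρ (y * x * y⁻¹) * ρ ((y * x * y⁻¹)⁻¹ * x ^ k) = ρ (y * x * y⁻¹) := by
      rw [hy, mul_one]
    rw [← map_mul, mul_inv_cancel_left] at h1
    rw [hA, ← map_pow, h1, ← map_mul, ← map_mul]
    congr 1
    group
  have hstep {v : Fin n → ℂ} {c : ℂ} (hv : A v = c • v) : A (ρ y v) = c ^ k' • ρ y v := by
    have h1 : (A ^ k) (ρ y v) = c • ρ y v := by
      rw [← Module.End.mul_apply, hconj, Module.End.mul_apply, hv, map_smul]
    have h2 := pow_apply_eigenvector h1 k'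
    rw [← pow_mul, ← Nat.div_add_mod (k * k') r, hk, pow_add, pow_mul, hAr, one_pow, one_mul,
      pow_one] at h2
    exact h2
  have hvec (i : ℕ) : A (ρ (y ^ i) (b i₀)) = μ i₀ ^ k' ^ i • ρ (y ^ i) (b i₀) := by
    induction i with
    | zero => simp [hb]
    | succ i ih =>
      have := hstep ih
      have h1 : ρ (y ^ (i + 1)) = ρ y * ρ (y ^ i) := by rw [← map_mul, ← pow_succ']
      rwa [h1, Module.End.mul_apply, pow_succ, pow_mul]
  have hne (i : ℕ) : ρ (y ^ i) (b i₀) ≠ 0 := by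
    intro h0
    have := congrArg (ρ (y ^ i)⁻¹) h0
    rw [← Module.End.mul_apply, ← map_mul, inv_mul_cancel, map_one, map_zero] at this
    exact b.ne_zero i₀ this
  have hli := A.eigenvectors_linearIndependent' (fun i : Fin s => μ i₀ ^ k' ^ (i : ℕ))
    (fun i j hij => hinj i j (by
      have h1 : μ i₀ ^ k' ^ (i : ℕ) = μ i₀ ^ k' ^ (j : ℕ) := hij
      rw [← pow_mod_orderOf, ← pow_mod_orderOf (μ i₀) (k' ^ (j : ℕ)), hord] at h1
      exact hprim.pow_inj (Nat.mod_lt _ hr.pos) (Nat.mod_lt _ hr.pos) h1))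
    (fun i => ρ (y ^ (i : ℕ)) (b i₀))
    (fun i => ⟨Module.End.mem_eigenspace_iff.2 (hvec i), hne i⟩)
  simpa using hli.fintype_card_le_finrank

end DegreeBound
section NormalSum

variable {G : Type} [Group G] [Fintype G]

/-- An irreducible character not containing `N` in its kernel sums to zero on cosets of `N`. -/
lemma sum_mul_eq_zero {χ : G → ℂ} (h : χ ∈ Irr G) (N : Subgroup G) [N.Normal]
    (hN : ¬ (N : Set G) ⊆ kerSet G χ) (x : G) : ∑ᶠ n : N, χ (x * n) = 0 := by
  classical
  rw [finsum_eq_sum_of_fintype]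
  obtain ⟨d, ρ, rfl⟩ := (isChar_of_mem_Irr h).exists_representation
  set p : Module.End ℂ (Fin d → ℂ) := ∑ n : N, ρ n with hp
  obtain ⟨c, hc⟩ := exists_eq_smul_one h p (by
    intro y
    rw [hp, Finset.sum_mul, Finset.mul_sum]
    refine Fintype.sum_equiv (MulAut.conjNormal y⁻¹).toEquiv _ _ fun n => ?_
    change ρ n * ρ y = ρ y * ρ (MulAut.conjNormal y⁻¹ n : N)
    rw [MulAut.conjNormal_apply, ← map_mul, ← map_mul]
    congr 1
    group)
  have hpn (n : N) : p * ρ n = p := by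
    rw [hp, Finset.sum_mul]
    refine Fintype.sum_equiv (Equiv.mulRight n) _ _ fun m => ?_
    rw [← map_mul]
    rfl
  have hp0 : p = 0 := by
    by_cases hc0 : c = 0
    · rw [hc, hc0, zero_smul]
    · exfalso
      refine hN fun n hn => ?_
      rw [mem_kerSet_iff]
      have h1 := hpn ⟨n, hn⟩
      rw [hc, smul_mul_assoc, one_mul] at h1
      exact smul_right_injective _ hc0 h1
  have h2 : LinearMap.trace ℂ _ (ρ x * p) = 0 := by rw [hp0, mul_zero, map_zero]
  rw [hp, Finset.mul_sum, map_sum] at h2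
  rw [← h2]
  exact Finset.sum_congr rfl fun n _ => by rw [Representation.character, map_mul]

lemma charInner_eq_zero_of_invariant {χ : G → ℂ} (h : χ ∈ Irr G) (N : Subgroup G) [N.Normal]
    (hN : ¬ (N : Set G) ⊆ kerSet G χ) {f : G → ℂ} (hf : ∀ x, ∀ n ∈ N, f (x * n) = f x) :
    charInner f χ = 0 := by
  classical
  have h1 : ∑ n : N, ∑ x, f x * χ x⁻¹ = 0 := by
    have h2 (n : N) : ∑ x, f x * χ x⁻¹ = ∑ x, f x * χ (x⁻¹ * ((n⁻¹ : N) : G)) := by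
      symm
      refine Fintype.sum_equiv (Equiv.mulRight (n : G)) _ _ fun x => ?_
      rw [Equiv.coe_mulRight, hf x n n.2, mul_inv_rev]
      have := (isChar_of_mem_Irr h).conj (x⁻¹ * (n : G)⁻¹) (n : G)⁻¹
      rw [Subgroup.coe_inv, ← this]
      congr 2
      group
    rw [Finset.sum_congr rfl fun n _ => h2 n, Finset.sum_comm]
    refine Finset.sum_eq_zero fun x _ => ?_
    rw [← Finset.mul_sum, Fintype.sum_equiv (Equiv.inv N) (fun n : N => χ (x⁻¹ * ((n⁻¹ : N) : G)))
      (fun n : N => χ (x⁻¹ * n)) (fun n => by simp)]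
    rw [← finsum_eq_sum_of_fintype, sum_mul_eq_zero h N hN, mul_zero]
  rw [Finset.sum_const, Finset.card_univ, nsmul_eq_mul, mul_eq_zero] at h1
  rcases h1 with h1 | h1
  · exact absurd (Nat.cast_eq_zero.1 h1) Fintype.card_ne_zero
  · rw [charInner, h1, mul_zero]

open Classical in
/-- The irreducible characters with `N` in the kernel. -/
noncomputable def irrOver (N : Subgroup G) : Finset (G → ℂ) :=
  (irr G).filter fun χ => (N : Set G) ⊆ kerSet G χ

open Classical in
/-- The irreducible characters without `N` in the kernel. -/
noncomputable def irrNot (N : Subgroup G) : Finset (G → ℂ) :=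
  (irr G).filter fun χ => ¬ (N : Set G) ⊆ kerSet G χ

lemma mem_irrOver {N : Subgroup G} {χ : G → ℂ} :
    χ ∈ irrOver N ↔ χ ∈ Irr G ∧ (N : Set G) ⊆ kerSet G χ := by
  simp [irrOver]

lemma mem_irrNot {N : Subgroup G} {χ : G → ℂ} :
    χ ∈ irrNot N ↔ χ ∈ Irr G ∧ ¬ (N : Set G) ⊆ kerSet G χ := by
  simp [irrNot]

/-- Expansion of an `N`-invariant class function. -/
lemma eq_sum_irrOver (N : Subgroup G) [N.Normal] {f : G → ℂ}
    (hf : ∀ x y, f (y * x * y⁻¹) = f x) (hN : ∀ x, ∀ n ∈ N, f (x * n) = f x) :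
    f = ∑ χ ∈ irrOver N, charInner f χ • χ := by
  classical
  conv_lhs => rw [eq_sum_irr hf]
  rw [irrOver, Finset.sum_filter]
  refine Finset.sum_congr rfl fun χ hχ => ?_
  split_ifs with h
  · rfl
  · rw [charInner_eq_zero_of_invariant (mem_irr.1 hχ) N h hN, zero_smul]

lemma sum_irrOver_sq (N : Subgroup G) [hN : N.Normal] :
    (Nat.card N) * ∑ χ ∈ irrOver N, charDeg G χ ^ 2 = Nat.card G := by
  classical
  let f : G → ℂ := fun x => if x ∈ N then 1 else 0
  have h1 := eq_sum_irrOver N (f := f)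
    (fun x y => by
      have : y * x * y⁻¹ ∈ N ↔ x ∈ N :=
        ⟨fun h => by simpa [mul_assoc] using hN.conj_mem _ h y⁻¹, fun h => hN.conj_mem _ h y⟩
      simp only [f, this])
    (fun x n hn => by
      have : x * n ∈ N ↔ x ∈ N := N.mul_mem_cancel_right hn
      simp only [f, this])
  have h2 := congrFun h1 1
  simp only [f, one_mem, if_true, Finset.sum_apply, Pi.smul_apply, smul_eq_mul] at h2
  have h3 (χ) (hχ : χ ∈ irrOver N) : charInner f χ = (Nat.card G : ℂ)⁻¹ * (Nat.card N * χ 1) := by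
    rw [charInner]
    congr 1
    simp only [f, ite_mul, one_mul, zero_mul]
    rw [← Finset.sum_filter, Finset.sum_congr rfl (g := fun _ => χ 1)]
    · rw [Finset.sum_const, nsmul_eq_mul, Nat.card_eq_fintype_card, Fintype.card_subtype]
    · intro x hx
      exact (mem_irrOver.1 hχ).2 (N.inv_mem (Finset.mem_filter.1 hx).2)
  rw [Finset.sum_congr rfl (g := fun χ => (Nat.card G : ℂ)⁻¹ * (Nat.card N * charDeg G χ ^ 2)),
    ← Finset.mul_sum, ← Finset.mul_sum] at h2
  · rw [eq_comm, inv_mul_eq_one₀ card_ne_zero] at h2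
    exact_mod_cast h2.symm
  · intro χ hχ
    have h4 : charInner f χ = (Nat.card G : ℂ)⁻¹ * (Nat.card N * χ 1) := h3 χ hχ
    change charInner f χ * χ 1 = _
    rw [h4, (isChar_of_mem_Irr (mem_irrOver.1 hχ).1).charDeg_eq]
    ring

lemma sum_irr_sq : ∑ χ ∈ irr G, charDeg G χ ^ 2 = Nat.card G := by
  classical
  have h1 := sum_irrOver_sq (⊥ : Subgroup G)
  have h2 : irrOver (⊥ : Subgroup G) = irr G := by
    ext χ
    simp [mem_irrOver, kerSet]
  rwa [h2, Subgroup.card_bot, one_mul] at h1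

lemma sum_irrNot_sq (N : Subgroup G) [N.Normal] :
    ∑ χ ∈ irrNot N, charDeg G χ ^ 2 = N.index * (Nat.card N - 1) := by
  classical
  have h1 := sum_irrOver_sq N
  have h2 := sum_irr_sq (G := G)
  have h3 := Finset.sum_filter_add_sum_filter_not (irr G)
    (fun χ => (N : Set G) ⊆ kerSet G χ) (fun χ => charDeg G χ ^ 2)
  rw [← N.index_mul_card] at h1 h2
  have h4 : ∑ χ ∈ irrOver N, charDeg G χ ^ 2 = N.index := by
    apply Nat.eq_of_mul_eq_mul_left (Nat.card_pos (α := N))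
    rw [h1, mul_comm]
  have h5 : ∑ χ ∈ irrOver N, charDeg G χ ^ 2 + ∑ χ ∈ irrNot N, charDeg G χ ^ 2
      = N.index * Nat.card N := by rw [← h2, ← h3]; rfl
  rw [Nat.mul_sub, mul_one, ← h5, h4, Nat.add_sub_cancel_left]

end NormalSum

section DegreeDvd

variable {G : Type} [Group G] [Fintype G]

/-- The degree of an irreducible character divides the index of its kernel. -/
lemma charDeg_dvd_index {χ : G → ℂ} (h : χ ∈ Irr G) {K : Subgroup G}
    (hK : (K : Set G) = kerSet G χ) : charDeg G χ ∣ K.index := by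
  classical
  have hχ := isChar_of_mem_Irr h
  have hdeg := hχ.charDeg_eq
  have hpos := charDeg_pos h
  have hone := charInner_self h
  obtain ⟨n, ρ, rfl⟩ := hχ.exists_representation
  obtain ⟨c, hc, hc'⟩ := sum_smul_eq_smul_one h (fun x y => hχ.conj x y)
  rw [hone, mul_one, ← hdeg] at hc'
  let F : G ⧸ K → Module.End ℂ (Fin n → ℂ) := fun q => ρ.character q.out⁻¹ • ρ q.out
  have hF (x : G) : ρ.character x⁻¹ • ρ x = F x := by
    obtain ⟨k, hk⟩ := QuotientGroup.mk_out_eq_mul K x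
    have hkK : (k : G) ∈ kerSet G ρ.character := hK ▸ k.2
    have hkK' : ((k : G)⁻¹) ∈ kerSet G ρ.character := hK ▸ K.inv_mem k.2
    have h1 : ρ.character (x * k)⁻¹ = ρ.character x⁻¹ := by
      rw [mul_inv_rev, ← hχ.conj _ (k : G)]
      simp only [mul_inv_cancel_left]
      exact hχ.mul_of_mem_kerSet hkK'
    simp only [F, hk, h1, map_mul]
    rw [(mem_kerSet_iff ρ _).1 hkK, mul_one]
  have hsum : ∑ x, ρ.character x⁻¹ • ρ x = (Nat.card K) • ∑ q, F q := by
    rw [Finset.smul_sum, ← Finset.sum_fiberwise Finset.univ (fun x : G => (x : G ⧸ K))]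
    refine Finset.sum_congr rfl fun q _ => ?_
    rw [Finset.sum_congr rfl (g := fun _ => F q), Finset.sum_const]
    · congr 1
      have := Nat.card_congr (QuotientGroup.preimageMkEquivSubgroupProdSet K {q})
      rw [Nat.card_prod, Nat.card_coe_set_eq {q}, Set.ncard_singleton, mul_one] at this
      rw [← this, Nat.card_eq_fintype_card, Fintype.card_subtype]
      congr 1
      ext x
      simp
    · intro x hx
      rw [hF, (Finset.mem_filter.1 hx).2]
  let s : ℂ := (Nat.card K : ℂ)⁻¹ * c
  have hKne : (Nat.card K : ℂ) ≠ 0 := card_ne_zero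
  have hs : ∑ q, F q = s • 1 := by
    rw [mul_smul, ← hc, hsum, ← Nat.cast_smul_eq_nsmul ℂ, smul_smul, inv_mul_cancel₀ hKne, one_smul]
  have hs' : s * charDeg G ρ.character = K.index := by
    rw [mul_assoc, hc', ← K.index_mul_card, Nat.cast_mul, mul_comm, mul_assoc,
      mul_inv_cancel₀ hKne, mul_one]
  let R := integralClosure ℤ ℂ
  let W : Submodule R (Module.End ℂ (Fin n → ℂ)) := Submodule.span R (Set.range ρ)
  have hn0 : Nontrivial (Fin n → ℂ) := by
    rw [← Module.finrank_pos_iff (R := ℂ)]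
    rw [Representation.char_one, Nat.cast_inj] at hdeg
    omega
  have hint : IsIntegral R s := by
    refine isIntegral_of_smul_mem_submodule W ?_ ?_ s ?_
    · rw [Submodule.ne_bot_iff]
      exact ⟨1, Submodule.subset_span ⟨1, map_one _⟩, one_ne_zero⟩
    · exact Submodule.fg_span (Set.finite_range _)
    · intro w hw
      have h1 : s • w = (∑ q, F q) * w := by rw [hs, smul_mul_assoc, one_mul]
      rw [h1]
      refine Submodule.span_induction (p := fun w _ => (∑ q, F q) * w ∈ W) ?_ ?_ ?_ ?_ hw
      · rintro _ ⟨x, rfl⟩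
        rw [Finset.sum_mul]
        refine W.sum_mem fun q _ => ?_
        rw [smul_mul_assoc, ← map_mul]
        exact W.smul_mem (⟨_, hχ.isIntegral q.out⁻¹⟩ : R) (Submodule.subset_span ⟨_, rfl⟩)
      · simp
      · intro a b _ _ ha hb
        rw [mul_add]
        exact W.add_mem ha hb
      · intro a b _ hb
        rw [mul_smul_comm]
        exact W.smul_mem a hb
  have hint' : IsIntegral ℤ s := isIntegral_trans s hint
  have hd0 : (charDeg G ρ.character : ℂ) ≠ 0 := by exact_mod_cast hpos.ne'
  have hsq : s = algebraMap ℚ ℂ ((K.index : ℚ) / charDeg G ρ.character) := by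
    rw [eq_ratCast]
    push_cast
    rw [eq_div_iff hd0, hs']
  rw [hsq, isIntegral_algebraMap_iff (algebraMap ℚ ℂ).injective] at hint'
  obtain ⟨z, hz⟩ := IsIntegrallyClosed.isIntegral_iff.1 hint'
  rw [eq_intCast, eq_div_iff (by exact_mod_cast hpos.ne')] at hz
  have hz' : z * (charDeg G ρ.character : ℤ) = K.index := by exact_mod_cast hz
  exact Int.natCast_dvd_natCast.1 ⟨z, by rw [← hz', mul_comm]⟩

end DegreeDvd
section GroupTheory

variable {G Q : Type} [Group G] [Group Q] {f : G →* Q}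

/-- If all elements of the coset `x ker f` are conjugate to `x`, and `f x` has self-centralizing
cyclic group, then `ker f` acts transitively on this coset. -/
lemma exists_ker_conj {x : G} (hconj : ∀ n ∈ f.ker, IsConj x (x * n))
    (hcent : ∀ y, f y * f x = f x * f y → f y ∈ Subgroup.zpowers (f x)) {n : G}
    (hn : n ∈ f.ker) : ∃ z ∈ f.ker, z * x * z⁻¹ = x * n := by
  obtain ⟨y, hy⟩ := isConj_iff.1 (hconj n hn)
  have h1 : f y * f x = f x * f y := by
    have := congrArg f hy
    simp only [map_mul, map_inv, MonoidHom.mem_ker.1 hn, mul_one] at this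
    exact mul_inv_eq_iff_eq_mul.1 this
  obtain ⟨i, hi⟩ := hcent y h1
  refine ⟨y * (x ^ i)⁻¹, ?_, ?_⟩
  · simp only [MonoidHom.mem_ker, map_mul, map_inv, map_zpow, ← hi]
    exact mul_inv_cancel _
  · rw [← hy]
    group

lemma eq_one_of_commute [Finite G] {x : G} (hconj : ∀ n ∈ f.ker, IsConj x (x * n))
    (hcent : ∀ y, f y * f x = f x * f y → f y ∈ Subgroup.zpowers (f x)) {n : G}
    (hn : n ∈ f.ker) (hc : n * x = x * n) : n = 1 := by
  let φ : f.ker → f.ker := fun z => ⟨x⁻¹ * (z * x * (z : G)⁻¹), by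
    simp [MonoidHom.mem_ker, MonoidHom.mem_ker.1 z.2]⟩
  have hsurj : Function.Surjective φ := by
    intro w
    obtain ⟨z, hz, h⟩ := exists_ker_conj hconj hcent w.2
    exact ⟨⟨z, hz⟩, Subtype.ext (by simp [φ, h])⟩
  have hinj := Finite.injective_iff_surjective.2 hsurj
  have : (⟨n, hn⟩ : f.ker) = 1 := hinj (Subtype.ext (by simp [φ, hc]))
  exact congrArg Subtype.val this

/-- The final contradiction: if every coset of `ker f` outside `ker f` is contained in a
conjugacy class, and the image contains a suitable `S₃`, then `ker f` is trivial. -/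
lemma ker_eq_bot [Finite G] (hf : Function.Surjective f)
    (hall : ∀ x, f x ≠ 1 → ∀ n ∈ f.ker, IsConj x (x * n)) {a b : Q} (ha : a ≠ 1) (ha3 : a ^ 3 = 1)
    (hb : b * a * b⁻¹ = a⁻¹) (hb2 : b ^ 2 = 1)
    (hcent : ∀ y, y * a = a * y → y ∈ Subgroup.zpowers a) : f.ker = ⊥ := by
  obtain ⟨u, rfl⟩ := hf a
  obtain ⟨t, rfl⟩ := hf b
  have haa : f u ≠ (f u)⁻¹ := by
    intro h
    apply ha
    rw [eq_inv_iff_mul_eq_one] at h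
    rw [← ha3, pow_succ, pow_two, h, one_mul]
  have hu := hall u ha
  have hcent' (y : G) (h : f y * f u = f u * f y) := hcent (f y) h
  have hfix {n : G} (hn : n ∈ f.ker) (hc : n * u = u * n) : n = 1 :=
    eq_one_of_commute hu hcent' hn hc
  obtain ⟨z, hz, hz'⟩ := exists_ker_conj hu hcent' (n := u⁻¹ * (t * u⁻¹ * t⁻¹)) (by
    have := congrArg Inv.inv hb
    rw [MonoidHom.mem_ker]
    simp only [map_mul, map_inv, mul_inv_rev, inv_inv] at this ⊢
    rw [mul_assoc (f t), this, inv_mul_cancel])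
  rw [mul_inv_cancel_left] at hz'
  set s := z⁻¹ * t with hs
  have hfs : f s = f t := by rw [hs, map_mul, map_inv, MonoidHom.mem_ker.1 hz]; simp
  have hsu : s * u⁻¹ * s⁻¹ = u := by
    have : s * u⁻¹ * s⁻¹ = z⁻¹ * (t * u⁻¹ * t⁻¹) * z := by rw [hs]; group
    rw [this, ← hz']
    group
  have hsu' : s * u * s⁻¹ = u⁻¹ := by
    have := congrArg Inv.inv hsu
    rw [← this]
    group
  have hs2 : s * s = 1 := by
    refine hfix ?_ ?_
    · rw [MonoidHom.mem_ker, map_mul, hfs, ← pow_two, hb2]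
    · have h1 : s * s * u * (s * s)⁻¹ = u := by
        calc s * s * u * (s * s)⁻¹ = s * (s * u * s⁻¹) * s⁻¹ := by group
          _ = u := by rw [hsu', hsu]
      exact mul_inv_eq_iff_eq_mul.1 h1
  have hinvert {x : G} (hx : f x ≠ 1) (hx2 : x * x = 1) {n : G} (hn : n ∈ f.ker) :
      x * n * x⁻¹ = n⁻¹ := by
    obtain ⟨c, hc⟩ := isConj_iff.1 (hall x hx n hn)
    have h1 : (x * n) * (x * n) = 1 := by
      rw [← hc]
      calc c * x * c⁻¹ * (c * x * c⁻¹) = c * (x * x) * c⁻¹ := by group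
        _ = 1 := by rw [hx2]; group
    rw [← inv_eq_of_mul_eq_one_right hx2] at h1 ⊢
    rw [inv_inv, eq_inv_iff_mul_eq_one, ← h1]
    rw [inv_eq_of_mul_eq_one_right hx2]
    group
  have hfs1 : f s ≠ 1 := by
    intro h
    rw [hfs] at h
    rw [h] at hb
    exact haa (by simpa using hb)
  have hsu1 : f (s * u) ≠ 1 := by
    intro h
    rw [map_mul, hfs, mul_eq_one_iff_eq_inv] at h
    rw [h] at hb
    exact haa (by simpa using hb)
  have hsu2 : s * u * (s * u) = 1 := by
    have : s⁻¹ = s := inv_eq_of_mul_eq_one_right hs2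
    rw [this] at hsu'
    rw [← mul_assoc, hsu', inv_mul_cancel]
  rw [eq_bot_iff]
  intro n hn
  rw [Subgroup.mem_bot]
  refine hfix hn ?_
  have hn' : u * n * u⁻¹ ∈ f.ker := f.normal_ker.conj_mem n hn u
  have h1 := hinvert hfs1 hs2 hn'
  have h2 := hinvert hsu1 hsu2 hn
  have h3 : s * (u * n * u⁻¹) * s⁻¹ = s * u * n * (s * u)⁻¹ := by group
  rw [h3, h2, inv_inj] at h1
  rw [eq_comm, ← mul_inv_eq_iff_eq_mul]
  exact h1.symm

/-- A subgroup whose order is divisible by a prime `r` exactly dividing the group order contains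
a conjugate of every element of order `r`. -/
lemma exists_conj_mem_of_dvd [Finite Q] {r : ℕ} [hr : Fact r.Prime]
    (hQ : (Nat.card Q).factorization r = 1) {g : Q} (hg : orderOf g = r) (T : Subgroup Q)
    (hT : r ∣ Nat.card T) : ∃ w, w * g * w⁻¹ ∈ T := by
  obtain ⟨y, hy⟩ := exists_prime_orderOf_dvd_card' r hT
  have hy' : orderOf (y : Q) = r := by rw [Subgroup.orderOf_coe, hy]
  let P₁ : Sylow r Q := Sylow.ofCard (Subgroup.zpowers g) (by rw [Nat.card_zpowers, hg, hQ, pow_one])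
  let P₂ : Sylow r Q := Sylow.ofCard (Subgroup.zpowers (y : Q))
    (by rw [Nat.card_zpowers, hy', hQ, pow_one])
  obtain ⟨w, hw⟩ := MulAction.exists_smul_eq Q P₁ P₂
  refine ⟨w, ?_⟩
  have h1 : w * g * w⁻¹ ∈ (P₂ : Subgroup Q) := by
    rw [← hw]
    exact Subgroup.smul_mem_pointwise_smul g (MulAut.conj w) _ (Subgroup.mem_zpowers g)
  exact (Subgroup.zpowers_le.2 y.2) h1

end GroupTheory
section Separation

variable {G : Type} [Group G] [Fintype G]

/-- Irreducible characters separate conjugacy classes. -/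
lemma isConj_of_forall_Irr {x y : G} (h : ∀ χ ∈ Irr G, χ x = χ y) : IsConj x y := by
  classical
  let f : G → ℂ := fun z => if IsConj x z then 1 else 0
  have hf : ∀ z w, f (w * z * w⁻¹) = f z := by
    intro z w
    have h1 : IsConj z (w * z * w⁻¹) := isConj_iff.2 ⟨w, rfl⟩
    have h2 : IsConj x (w * z * w⁻¹) ↔ IsConj x z := ⟨fun h => h.trans h1.symm, fun h => h.trans h1⟩
    simp only [f, h2]
  have h1 : f x = f y := by
    rw [eq_sum_irr hf]
    simp only [Finset.sum_apply, Pi.smul_apply]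
    exact Finset.sum_congr rfl fun χ hχ => by rw [h χ (mem_irr.1 hχ)]
  by_contra hc
  simp only [f, hc, IsConj.refl, if_true, if_false] at h1
  exact one_ne_zero h1

lemma exists_irrOver_apply_ne {Q : Type} [Group Q] (f : G →* Q) {x y : G}
    (h : ¬ IsConj (f x) (f y)) : ∃ χ ∈ irrOver f.ker, χ x ≠ χ y := by
  classical
  by_contra! hc
  let F : G → ℂ := fun z => if IsConj (f x) (f z) then 1 else 0
  have hF : ∀ z w, F (w * z * w⁻¹) = F z := by
    intro z w
    have h1 : IsConj (f z) (f (w * z * w⁻¹)) := isConj_iff.2 ⟨f w, by simp⟩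
    have h2 : IsConj (f x) (f (w * z * w⁻¹)) ↔ IsConj (f x) (f z) :=
      ⟨fun h => h.trans h1.symm, fun h => h.trans h1⟩
    simp only [F, h2]
  have hN : ∀ z, ∀ n ∈ f.ker, F (z * n) = F z := by
    intro z n hn
    simp only [F, map_mul, MonoidHom.mem_ker.1 hn, mul_one]
  have h1 : F x = F y := by
    rw [eq_sum_irrOver f.ker hF hN]
    simp only [Finset.sum_apply, Pi.smul_apply]
    exact Finset.sum_congr rfl fun χ hχ => by rw [hc χ hχ]
  simp only [F, h, IsConj.refl, if_true, if_false] at h1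
  exact one_ne_zero h1

lemma exists_irrOver_ne_one (N : Subgroup G) [N.Normal] (h : N ≠ ⊤) : ∃ χ ∈ irrOver N, χ ≠ 1 := by
  obtain ⟨x, hx⟩ : ∃ x, x ∉ N := by
    by_contra! hc
    exact h (eq_top_iff.2 fun x _ => hc x)
  obtain ⟨χ, hχ, hne⟩ := exists_irrOver_apply_ne (QuotientGroup.mk' N) (x := 1) (y := x) (by
    rw [map_one, isConj_one_right]
    exact fun h => hx ((QuotientGroup.eq_one_iff x).1 h))
  rw [QuotientGroup.ker_mk'] at hχ
  exact ⟨χ, hχ, fun h => hne (by rw [h]; rfl)⟩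

/-- If `σ` fixes all irreducible characters that do not contain `N` in their kernel, then these
vanish wherever some character of the quotient by `N` is moved by `σ`. -/
lemma apply_eq_zero_of_map_ne (N : Subgroup G) [N.Normal] {σ : ℂ →+* ℂ}
    (hσ : ∀ φ ∈ irrNot N, ∀ x, σ (φ x) = φ x) {χ ψ : G → ℂ} (hχ : χ ∈ irrOver N)
    (hψ : ψ ∈ irrNot N) {x : G} (hx : σ (χ x) ≠ χ x) : ψ x = 0 := by
  classical
  have hχ' := isChar_of_mem_Irr (mem_irrOver.1 hχ).1
  have hψ' := isChar_of_mem_Irr (mem_irrNot.1 hψ).1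
  have hc := hχ'.mul hψ'
  have hfix : σ ((χ * ψ) x) = (χ * ψ) x := by
    rw [eq_sum_irr (fun x y => hc.conj x y)]
    simp only [Finset.sum_apply, Pi.smul_apply, smul_eq_mul, map_sum, map_mul]
    refine Finset.sum_congr rfl fun φ hφ => ?_
    by_cases hφN : (N : Set G) ⊆ kerSet G φ
    · have h0 : charInner (χ * ψ) φ = 0 := by
        have hφ' := isChar_of_mem_Irr (mem_irr.1 hφ)
        have h1 := charInner_eq_zero_of_invariant (mem_irrNot.1 hψ).1 N (mem_irrNot.1 hψ).2
          (f := fun x => χ x⁻¹ * φ x) (by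
            intro x n hn
            have h2 := (mem_irrOver.1 hχ).2 (N.inv_mem hn)
            rw [hφ'.mul_of_mem_kerSet (hφN hn), mul_inv_rev, ← hχ'.conj _ n]
            simp only [mul_inv_cancel_left]
            rw [hχ'.mul_of_mem_kerSet h2])
        rw [charInner_comm, ← h1]
        simp only [charInner, Pi.mul_apply]
        congr 1
        exact Finset.sum_congr rfl fun x _ => by ring
      rw [h0]
      simp
    · obtain ⟨n, hn⟩ := hc.exists_charInner_eq (isChar_of_mem_Irr (mem_irr.1 hφ))
      rw [hn, map_natCast, hσ φ (mem_irrNot.2 ⟨mem_irr.1 hφ, hφN⟩)]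
  rw [Pi.mul_apply, map_mul, hσ ψ hψ, ← sub_eq_zero, ← sub_mul, mul_eq_zero, sub_eq_zero] at hfix
  exact hfix.resolve_left hx

lemma isConj_mul_of_irrNot_eq_zero (N : Subgroup G) {x : G}
    (h : ∀ ψ ∈ irrNot N, ∀ n ∈ N, ψ (x * n) = 0) {n : G} (hn : n ∈ N) : IsConj x (x * n) := by
  refine isConj_of_forall_Irr fun χ hχ => ?_
  by_cases hN : (N : Set G) ⊆ kerSet G χ
  · exact ((isChar_of_mem_Irr hχ).mul_of_mem_kerSet (hN hn)).symm
  · have := h χ (mem_irrNot.2 ⟨hχ, hN⟩)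
    rw [this n hn, ← mul_one x, this 1 N.one_mem]

end Separation

section Integrality

lemma dvd_of_eq_mul_isIntegral {a r : ℕ} (hr : r ≠ 0) {α : ℂ} (hα : IsIntegral ℤ α)
    (h : (a : ℂ) = r * α) : r ∣ a := by
  have hr' : (r : ℂ) ≠ 0 := by exact_mod_cast hr
  have hsq : α = algebraMap ℚ ℂ ((a : ℚ) / r) := by
    rw [eq_ratCast]
    push_cast
    rw [eq_div_iff hr', h, mul_comm]
  rw [hsq, isIntegral_algebraMap_iff (algebraMap ℚ ℂ).injective] at hα
  obtain ⟨z, hz⟩ := IsIntegrallyClosed.isIntegral_iff.1 hα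
  rw [eq_intCast, eq_div_iff (by exact_mod_cast hr)] at hz
  have hz' : z * (r : ℤ) = a := by exact_mod_cast hz
  exact Int.natCast_dvd_natCast.1 ⟨z, by rw [← hz', mul_comm]⟩

lemma dvd_card_of_forall_ne {X : Type} [Fintype X] {r k : ℕ} [hr : Fact r.Prime]
    (π : Equiv.Perm X) (hπ : π ^ r ^ k = 1) (hfix : ∀ x, π x ≠ x) : r ∣ Fintype.card X := by
  classical
  have hπ' : (MulAction.toEndHom π : Function.End X) ^ r ^ k = 1 := by
    rw [← map_pow, hπ, map_one]
  refine (Nat.modEq_zero_iff_dvd).1 ((Equiv.Perm.card_fixedPoints_modEq hπ').trans ?_)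
  have : IsEmpty (Function.fixedPoints (MulAction.toEndHom π : X → X)) := ⟨fun x => hfix x.1 x.2⟩
  exact (Fintype.card_eq_zero_iff.2 this) ▸ Nat.ModEq.refl _

/-- A sum of algebraic integers over a set with a fixed point free permutation of `r`-power
order preserving the summand is divisible by `r`. -/
lemma exists_sum_eq_mul_isIntegral {X : Type} [Fintype X] {r k : ℕ} [hr : Fact r.Prime]
    (π : Equiv.Perm X) (hπ : π ^ r ^ k = 1) (hfix : ∀ x, π x ≠ x) {F : X → ℂ}
    (hF : ∀ x, F (π x) = F x) (hint : ∀ x, IsIntegral ℤ (F x)) :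
    ∃ α : ℂ, IsIntegral ℤ α ∧ ∑ x, F x = r * α := by
  classical
  have hdvd (v : ℂ) : r ∣ (Finset.univ.filter fun x => F x = v).card := by
    let τ : Equiv.Perm {x // F x = v} := π.subtypePerm fun x => by rw [hF]
    rw [← Fintype.card_subtype]
    refine dvd_card_of_forall_ne (k := k) τ ?_ fun x hx => hfix x.1 ?_
    · ext x
      simp [τ, Equiv.Perm.subtypePerm_pow, hπ]
    · simpa [τ] using congrArg Subtype.val hx
  choose c hc using hdvd
  refine ⟨∑ v ∈ Finset.univ.image F, c v * v, ?_, ?_⟩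
  · refine IsIntegral.sum _ fun v hv => ?_
    obtain ⟨x, -, rfl⟩ := Finset.mem_image.1 hv
    have h1 : IsIntegral ℤ (c (F x) : ℂ) := by
      simpa using isIntegral_algebraMap (R := ℤ) (A := ℂ) (x := (c (F x) : ℤ))
    exact h1.mul (hint x)
  · rw [← Finset.sum_fiberwise_of_maps_to (g := F) (t := Finset.univ.image F)
      (fun x _ => Finset.mem_image_of_mem _ (Finset.mem_univ x)), Finset.mul_sum]
    refine Finset.sum_congr rfl fun v _ => ?_
    rw [Finset.sum_congr rfl (g := fun _ => v) fun x hx => (Finset.mem_filter.1 hx).2,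
      Finset.sum_const, hc, nsmul_eq_mul]
    push_cast
    ring

end Integrality
section Coprime

variable {H : Type} [Group H] [Fintype H]

lemma sum_eq_zero_of_ne_one {θ : H → ℂ} (hθ : θ ∈ Irr H) (h1 : θ ≠ 1) : ∑ x, θ x = 0 := by
  have h := charInner_eq_zero hθ one_mem_Irr h1
  simp only [charInner, Pi.one_apply, mul_one, mul_eq_zero, inv_eq_zero] at h
  exact h.resolve_left card_ne_zero

/-- A fixed point free automorphism of prime order fixes no nontrivial irreducible character. -/
lemma eq_one_of_comp_eq {r k : ℕ} [hr : Fact r.Prime] (σ : MulAut H) (hσ : σ ^ r ^ k = 1)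
    (hfix : ∀ x, σ x = x → x = 1) {θ : H → ℂ} (hθ : θ ∈ Irr H) (hinv : ∀ x, θ (σ x) = θ x) :
    θ = 1 := by
  classical
  by_contra h1
  have hr0 : (r : ℂ) ≠ 0 := by exact_mod_cast hr.out.ne_zero
  have hc := isChar_of_mem_Irr hθ
  let π : Equiv.Perm {x : H // x ≠ 1} :=
    Equiv.Perm.subtypePerm σ.toEquiv fun x => by simp
  have hπ : π ^ r ^ k = 1 := by
    ext x
    have h (n : ℕ) (x : {x : H // x ≠ 1}) : ((π ^ n) x : H) = (σ ^ n) x := by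
      induction n generalizing x with
      | zero => simp
      | succ n ih =>
        rw [pow_succ, pow_succ, Equiv.Perm.mul_apply, ih]
        rfl
    rw [h, hσ]
    rfl
  have hπfix : ∀ x, π x ≠ x := by
    intro x hx
    exact x.2 (hfix x (congrArg Subtype.val hx))
  have key {F : H → ℂ} (hF : ∀ x, F (σ x) = F x) (hint : ∀ x, IsIntegral ℤ (F x)) :
      ∃ α : ℂ, IsIntegral ℤ α ∧ ∑ x, F x = F 1 + r * α := by
    obtain ⟨α, hα, h⟩ := exists_sum_eq_mul_isIntegral π hπ hπfix (F := fun x => F x)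
      (fun x => hF x) (fun x => hint x)
    refine ⟨α, hα, ?_⟩
    rw [← h, ← Fintype.sum_subtype_add_sum_subtype (fun x => x = 1) F]
    have h1 : ((default : {x : H // x = 1}) : H) = 1 := rfl
    simp [h1]
  obtain ⟨α, hα, h2⟩ := key hinv hc.isIntegral
  obtain ⟨β, hβ, h3⟩ := key (F := fun x => θ x * θ x⁻¹)
    (fun x => by rw [← map_inv, hinv, hinv]) (fun x => (hc.isIntegral x).mul (hc.isIntegral _))
  obtain ⟨γ, hγ, h4⟩ := key (F := fun _ => 1) (fun _ => rfl) (fun _ => isIntegral_one)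
  rw [sum_eq_zero_of_ne_one hθ h1] at h2
  have h5 := charInner_self hθ
  rw [charInner, inv_mul_eq_one₀ card_ne_zero] at h5
  rw [← h5, inv_one] at h3
  have h6 : ((Nat.card H : ℕ) : ℂ) = 1 + r * γ := by
    rw [← h4]
    simp
  have h7 : ((1 : ℕ) : ℂ) = r * (r * α * α + β - γ) := by
    push_cast
    linear_combination h3 - h6 + (r * α - θ 1) * h2
  have h8 : IsIntegral ℤ (r * α * α + β - γ : ℂ) := by
    have hr' : IsIntegral ℤ (r : ℂ) := by
      simpa using isIntegral_algebraMap (R := ℤ) (A := ℂ) (x := (r : ℤ))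
    exact (((hr'.mul hα).mul hα).add hβ).sub hγ
  exact hr.out.one_lt.ne' (Nat.dvd_one.1 (dvd_of_eq_mul_isIntegral hr.out.ne_zero h8 h7))

end Coprime

section Clifford

variable {G : Type} [Group G] (M : Subgroup G)

/-- The multiplicity of `θ` in the restriction of `ψ`. -/
noncomputable def mult [Fintype M] (ψ : G → ℂ) (θ : M → ℂ) : ℂ := charInner (fun n : M => ψ n) θ

open Classical in
/-- The induced class function. -/
noncomputable def ind [Fintype G] (θ : M → ℂ) (x : G) : ℂ :=
  (Nat.card M : ℂ)⁻¹ * ∑ y : G, if h : y * x * y⁻¹ ∈ M then θ ⟨y * x * y⁻¹, h⟩ else 0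

/-- The conjugate of a character of a normal subgroup. -/
def conjChar [M.Normal] (y : G) (θ : M → ℂ) : M → ℂ := fun n => θ (MulAut.conjNormal y n)

variable {M}

lemma IsChar.restrict {ψ : G → ℂ} (hψ : IsChar ψ) : IsChar (fun n : M => ψ n) :=
  hψ.comp M.subtype

lemma exists_mult_eq [Fintype M] {ψ : G → ℂ} (hψ : IsChar ψ) {θ : M → ℂ} (hθ : IsChar θ) :
    ∃ n : ℕ, mult M ψ θ = n :=
  (hψ.restrict).exists_charInner_eq hθ

variable [hM : M.Normal]

lemma conjChar_mul (y z : G) (θ : M → ℂ) :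
    conjChar M (y * z) θ = conjChar M z (conjChar M y θ) := by
  ext n
  simp [conjChar]

lemma conjChar_one (θ : M → ℂ) : conjChar M 1 θ = θ := by
  ext n
  simp [conjChar]

lemma conjChar_of_mem {θ : M → ℂ} (hθ : IsChar θ) {y : G} (hy : y ∈ M) : conjChar M y θ = θ := by
  ext n
  rw [← hθ.conj n ⟨y, hy⟩]
  rfl

lemma conjChar_mem_Irr [Fintype M] (y : G) {θ : M → ℂ} (hθ : θ ∈ Irr M) : conjChar M y θ ∈ Irr M :=
  comp_mem_Irr hθ (MulAut.conjNormal y)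

lemma mult_conjChar [Fintype M] {ψ : G → ℂ} (hψ : IsChar ψ) (θ : M → ℂ) (y : G) :
    mult M ψ (conjChar M y θ) = mult M ψ θ := by
  unfold mult charInner
  congr 1
  refine Fintype.sum_equiv (MulAut.conjNormal y).toEquiv _ _ fun n => ?_
  change ψ n * θ (MulAut.conjNormal y n⁻¹) = ψ (MulAut.conjNormal y n : M) * _
  rw [MulAut.conjNormal_apply, hψ.conj, map_inv]
  rfl

variable [Fintype G]

lemma ind_of_notMem (θ : M → ℂ) {x : G} (hx : x ∉ M) : ind M θ x = 0 := by
  classical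
  rw [ind, Finset.sum_eq_zero, mul_zero]
  intro y _
  rw [dif_neg]
  intro h
  exact hx (by simpa [mul_assoc] using hM.conj_mem _ h y⁻¹)

lemma ind_coe (θ : M → ℂ) (n : M) :
    ind M θ n = (Nat.card M : ℂ)⁻¹ * ∑ y : G, conjChar M y θ n := by
  classical
  rw [ind]
  congr 1
  refine Finset.sum_congr rfl fun y _ => ?_
  rw [dif_pos (hM.conj_mem _ n.2 y)]
  rfl

lemma ind_conj (θ : M → ℂ) (x y : G) : ind M θ (y * x * y⁻¹) = ind M θ x := by
  classical
  unfold ind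
  congr 1
  refine Fintype.sum_equiv (Equiv.mulRight y) _ _ fun z => ?_
  have h : z * (y * x * y⁻¹) * z⁻¹ = z * y * x * (z * y)⁻¹ := by group
  rw [Equiv.coe_mulRight]
  congr! 2
  exact Subtype.ext h

variable [Fintype M]

/-- Frobenius reciprocity. -/
lemma charInner_ind (θ : M → ℂ) {F : G → ℂ} (hF : ∀ x y, F (y * x * y⁻¹) = F x) :
    charInner (ind M θ) F = mult M F θ := by
  classical
  have h1 (y : G) : ∑ x, (if h : y * x * y⁻¹ ∈ M then θ ⟨y * x * y⁻¹, h⟩ else 0) * F x⁻¹ =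
      ∑ n : M, F n * θ n⁻¹ := by
    have h2 : ∑ n : M, F n * θ n⁻¹ = ∑ n : M, θ n * F (n : G)⁻¹ :=
      Fintype.sum_equiv (Equiv.inv M) _ _ fun n => by simp [mul_comm]
    have h3 : ∑ n : M, θ n * F (n : G)⁻¹ =
        ∑ x, (if h : x ∈ M then θ ⟨x, h⟩ else 0) * F x⁻¹ := by
      rw [← Fintype.sum_subtype_add_sum_subtype (fun x => x ∈ M)
        (fun x => (if h : x ∈ M then θ ⟨x, h⟩ else 0) * F x⁻¹)]
      have h4 : ∑ x : {x // x ∉ M}, (if h : (x : G) ∈ M then θ ⟨x, h⟩ else 0) * F (x : G)⁻¹ = 0 :=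
        Finset.sum_eq_zero fun x _ => by rw [dif_neg x.2, zero_mul]
      rw [h4, add_zero]
      refine Finset.sum_congr (by ext; simp) fun n _ => by rw [dif_pos n.2]
    rw [h2, h3]
    refine Fintype.sum_equiv (MulAut.conj y).toEquiv _ _ fun x => ?_
    change _ = (if h : y * x * y⁻¹ ∈ M then θ ⟨y * x * y⁻¹, h⟩ else 0) * F (y * x * y⁻¹)⁻¹
    rw [← hF x⁻¹ y]
    simp [mul_assoc]
  unfold mult charInner ind
  simp only [mul_assoc, Finset.sum_mul, ← Finset.mul_sum]
  rw [Finset.sum_comm]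
  simp only [← mul_assoc (_ : G)] at h1 ⊢
  rw [Finset.sum_congr rfl fun y _ => h1 y, Finset.sum_const, Finset.card_univ, nsmul_eq_mul,
    ← Nat.card_eq_fintype_card]
  have := card_ne_zero (G := G)
  field_simp

lemma ind_eq_sum {θ : M → ℂ} : ind M θ = ∑ ψ ∈ irr G, mult M ψ θ • ψ := by
  refine (eq_sum_irr (ind_conj θ)).trans (Finset.sum_congr rfl fun ψ hψ => ?_)
  rw [← charInner_ind θ (isChar_of_mem_Irr (mem_irr.1 hψ)).conj]

open Classical in
lemma sum_mult_mul_mult {θ θ' : M → ℂ} (hθ : θ ∈ Irr M) (hθ' : θ' ∈ Irr M) :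
    ∑ ψ ∈ irr G, mult M ψ θ * mult M ψ θ' =
      (Nat.card M : ℂ)⁻¹ * (Finset.univ.filter fun y : G => conjChar M y θ = θ').card := by
  have h1 : (fun n : M => ind M θ n) = ∑ ψ ∈ irr G, mult M ψ θ • fun n : M => ψ n := by
    ext n
    rw [ind_eq_sum]
    simp
  have h2 : (fun n : M => ind M θ n) = ∑ y : G, (Nat.card M : ℂ)⁻¹ • conjChar M y θ := by
    ext n
    rw [ind_coe]
    simp [Finset.mul_sum]
  have h3 := charInner_sum_left (irr G) (fun ψ (n : M) => ψ n) (fun ψ => mult M ψ θ) θ'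
  rw [← h1, h2, charInner_sum_left] at h3
  refine h3.symm.trans ?_
  rw [← Finset.mul_sum]
  congr 1
  rw [Finset.card_filter]
  push_cast
  refine Finset.sum_congr rfl fun y _ => ?_
  split_ifs with h
  · rw [h, charInner_self hθ']
  · exact charInner_eq_zero (conjChar_mem_Irr y hθ) hθ' h

end Clifford
section Clifford

variable {G : Type} [Group G] [Fintype G] {M : Subgroup G} [hM : M.Normal] [Fintype M]

lemma charDeg_eq_of_mult_eq {ψ₁ ψ₂ : G → ℂ} (h₁ : ψ₁ ∈ Irr G) (h₂ : ψ₂ ∈ Irr G) {θ : M → ℂ}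
    (hθ : θ ∈ Irr M) (h : mult M ψ₁ θ = mult M ψ₂ θ) (h0 : mult M ψ₁ θ ≠ 0) :
    charDeg G ψ₁ = charDeg G ψ₂ := by
  classical
  have hdeg {ψ : G → ℂ} (hψ : ψ ∈ Irr G) :
      (charDeg G ψ : ℂ) = ∑ φ ∈ irr M, mult M ψ φ * φ 1 := by
    have hr := (isChar_of_mem_Irr hψ).restrict (M := M)
    have := congrFun (eq_sum_irr (f := fun n : M => ψ n) fun x y => hr.conj x y) 1
    rw [(isChar_of_mem_Irr hψ).charDeg_eq]
    simpa [mult] using this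
  have hmult (φ : M → ℂ) (hφ : φ ∈ Irr M) : mult M ψ₁ φ = mult M ψ₂ φ := by
    by_cases hc : ∃ y, conjChar M y θ = φ
    · obtain ⟨y, rfl⟩ := hc
      rw [mult_conjChar (isChar_of_mem_Irr h₁), mult_conjChar (isChar_of_mem_Irr h₂), h]
    · have hs := sum_mult_mul_mult hθ hφ
      rw [Finset.filter_false_of_mem fun y _ hy => hc ⟨y, hy⟩, Finset.card_empty, Nat.cast_zero,
        mul_zero] at hs
      have key {ψ : G → ℂ} (hψ : ψ ∈ Irr G) (hne : mult M ψ θ ≠ 0) : mult M ψ φ = 0 := by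
        have hnat (ξ : G → ℂ) : ∃ n : ℕ, ξ ∈ irr G → mult M ξ θ * mult M ξ φ = n := by
          by_cases hξ : ξ ∈ irr G
          · have hξ' := isChar_of_mem_Irr (mem_irr.1 hξ)
            obtain ⟨a, ha⟩ := exists_mult_eq hξ' (isChar_of_mem_Irr hθ)
            obtain ⟨b, hb⟩ := exists_mult_eq hξ' (isChar_of_mem_Irr hφ)
            exact ⟨a * b, fun _ => by rw [ha, hb, Nat.cast_mul]⟩
          · exact ⟨0, fun h => absurd h hξ⟩
        choose n hn using hnat
        rw [Finset.sum_congr rfl fun ξ hξ => hn ξ hξ, ← Nat.cast_sum, Nat.cast_eq_zero,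
          Finset.sum_eq_zero_iff] at hs
        have h1 := hn ψ (mem_irr.2 hψ)
        rw [hs ψ (mem_irr.2 hψ), Nat.cast_zero, mul_eq_zero] at h1
        exact h1.resolve_left hne
      rw [key h₁ h0, key h₂ (h ▸ h0)]
  have : (charDeg G ψ₁ : ℂ) = charDeg G ψ₂ := by
    rw [hdeg h₁, hdeg h₂]
    exact Finset.sum_congr rfl fun φ hφ => by rw [hmult φ (mem_irr.1 hφ)]
  exact_mod_cast this

lemma mem_irrNot_of_mult_ne_zero {ψ : G → ℂ} (hψ : ψ ∈ Irr G) {θ : M → ℂ} (hθ : θ ∈ Irr M)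
    (h1 : θ ≠ 1) (h : mult M ψ θ ≠ 0) : ψ ∈ irrNot M := by
  refine mem_irrNot.2 ⟨hψ, fun hker => h ?_⟩
  rw [mult, charInner_comm, charInner]
  have (n : M) : ψ (n⁻¹ : M) = ψ 1 := hker (n⁻¹).2
  simp only [this, ← Finset.sum_mul, sum_eq_zero_of_ne_one hθ h1, zero_mul, mul_zero]

lemma exists_mult_ne_zero {ψ : G → ℂ} (hψ : ψ ∈ irrNot M) :
    ∃ θ ∈ Irr M, θ ≠ 1 ∧ mult M ψ θ ≠ 0 := by
  classical
  by_contra! hc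
  refine (mem_irrNot.1 hψ).2 fun n hn => ?_
  have hr := (isChar_of_mem_Irr (mem_irrNot.1 hψ).1).restrict (M := M)
  have h1 := eq_sum_irr (f := fun n : M => ψ n) fun x y => hr.conj x y
  rw [Finset.sum_eq_single_of_mem 1 (mem_irr.2 one_mem_Irr)] at h1
  · have h2 := congrFun h1 ⟨n, hn⟩
    have h3 := congrFun h1 1
    simp only [Pi.smul_apply, Pi.one_apply, Subgroup.coe_one] at h2 h3
    change ψ n = ψ 1
    rw [h2, ← h3]
  · intro θ hθ hne
    have := hc θ (mem_irr.1 hθ) hne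
    rw [mult] at this
    rw [this, zero_smul]

variable (M) in
/-- The inertia group of a character of a normal subgroup. -/
def inertia (θ : M → ℂ) : Subgroup G where
  carrier := {y | conjChar M y θ = θ}
  mul_mem' {y z} hy hz := by
    change conjChar M (y * z) θ = θ
    rw [conjChar_mul, hy.out, hz.out]
  one_mem' := conjChar_one θ
  inv_mem' {y} hy := by
    change conjChar M y⁻¹ θ = θ
    conv_lhs => rw [← hy.out]
    rw [← conjChar_mul, mul_inv_cancel, conjChar_one]

lemma sum_mult_sq {θ : M → ℂ} (hθ : θ ∈ Irr M) :
    ∑ ψ ∈ irr G, mult M ψ θ ^ 2 = M.relIndex (inertia M θ) := by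
  classical
  have h1 := sum_mult_mul_mult hθ hθ
  have hle : M ≤ inertia M θ := fun y hy => conjChar_of_mem (isChar_of_mem_Irr hθ) hy
  have h2 : (Finset.univ.filter fun y : G => conjChar M y θ = θ).card = Nat.card (inertia M θ) := by
    rw [← Fintype.card_subtype, ← Nat.card_eq_fintype_card]
    rfl
  simp only [pow_two]
  rw [h1, h2, ← (inertia M θ).relIndex_bot_left, ← Subgroup.relIndex_mul_relIndex _ _ _ bot_le hle,
    Subgroup.relIndex_bot_left, Nat.cast_mul, inv_mul_cancel_left₀ card_ne_zero]

lemma card_eq_one_of_sum_sq_dvd {E : Finset ℕ} (h0 : 0 ∉ E) (h : ∑ e ∈ E, e ^ 2 ∣ 24) :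
    E.card = 1 := by
  have h1 : E ∈ (Finset.range 5).powerset := by
    rw [Finset.mem_powerset]
    intro e he
    have h2 : e ^ 2 ≤ ∑ e ∈ E, e ^ 2 :=
      Finset.single_le_sum (f := fun e => e ^ 2) (fun _ _ => Nat.zero_le _) he
    have h3 := Nat.le_of_dvd (by norm_num) h
    rw [Finset.mem_range]
    nlinarith
  have key : ∀ E ∈ (Finset.range 5).powerset, 0 ∉ E → ∑ e ∈ E, e ^ 2 ∣ 24 → E.card = 1 := by
    decide
  exact key E h1 h0 h

/-- If the characters outside `M` have distinct degrees and the ramification is small, they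
are fully ramified over `M`. -/
lemma apply_eq_zero_of_relIndex_dvd
    (hdeg : ∀ ψ₁ ∈ irrNot M, ∀ ψ₂ ∈ irrNot M, charDeg G ψ₁ = charDeg G ψ₂ → ψ₁ = ψ₂)
    (hdvd : ∀ θ ∈ Irr M, θ ≠ 1 → M.relIndex (inertia M θ) ∣ 24)
    {ψ : G → ℂ} (hψ : ψ ∈ irrNot M) {x : G} (hx : x ∉ M) : ψ x = 0 := by
  classical
  obtain ⟨θ, hθ, hθ1, hne⟩ := exists_mult_ne_zero hψ
  have hnat (ξ : G → ℂ) : ∃ n : ℕ, ξ ∈ irr G → mult M ξ θ = n := by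
    by_cases hξ : ξ ∈ irr G
    · obtain ⟨a, ha⟩ := exists_mult_eq (isChar_of_mem_Irr (mem_irr.1 hξ)) (isChar_of_mem_Irr hθ)
      exact ⟨a, fun _ => ha⟩
    · exact ⟨0, fun h => absurd h hξ⟩
  choose e he using hnat
  set S := (irr G).filter fun ξ => e ξ ≠ 0 with hS
  have hSmult {ξ} (hξ : ξ ∈ S) : ξ ∈ irr G ∧ mult M ξ θ = e ξ ∧ mult M ξ θ ≠ 0 := by
    rw [hS, Finset.mem_filter] at hξ
    refine ⟨hξ.1, he ξ hξ.1, ?_⟩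
    rw [he ξ hξ.1]
    exact_mod_cast hξ.2
  have hinj : Set.InjOn e S := by
    intro ξ₁ hξ₁ ξ₂ hξ₂ h
    obtain ⟨h1, h2, h3⟩ := hSmult hξ₁
    obtain ⟨h1', h2', h3'⟩ := hSmult hξ₂
    rw [mem_irr] at h1 h1'
    refine hdeg _ (mem_irrNot_of_mult_ne_zero h1 hθ hθ1 h3) _
      (mem_irrNot_of_mult_ne_zero h1' hθ hθ1 h3') ?_
    exact charDeg_eq_of_mult_eq h1 h1' hθ (by rw [h2, h2', h]) h3
  have hsum : ∑ n ∈ S.image e, n ^ 2 = M.relIndex (inertia M θ) := by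
    rw [Finset.sum_image hinj, hS, Finset.sum_filter_of_ne (by
      intro ξ _ h h0
      simp [h0] at h)]
    have := sum_mult_sq hθ
    rw [Finset.sum_congr rfl fun ξ hξ => by rw [he ξ hξ]] at this
    exact_mod_cast this
  have hcard := card_eq_one_of_sum_sq_dvd (E := S.image e) (by simp [hS]) (hsum ▸ hdvd θ hθ hθ1)
  rw [Finset.card_image_of_injOn hinj, Finset.card_eq_one] at hcard
  obtain ⟨ξ, hξ⟩ := hcard
  have hψirr : ψ ∈ irr G := mem_irr.2 (mem_irrNot.1 hψ).1
  have hψS : ψ ∈ S := by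
    rw [hS, Finset.mem_filter]
    refine ⟨hψirr, fun h => hne ?_⟩
    rw [he ψ hψirr, h, Nat.cast_zero]
  have hind := congrFun (ind_eq_sum (θ := θ)) x
  rw [ind_of_notMem θ hx, Finset.sum_eq_single_of_mem ψ hψirr, Pi.smul_apply, smul_eq_mul, eq_comm,
    mul_eq_zero] at hind
  · exact hind.resolve_left hne
  · intro φ hφ hφψ
    have : φ ∉ S := by
      intro h
      rw [hξ, Finset.mem_singleton] at h hψS
      exact hφψ (h.trans hψS.symm)
    have h0 : e φ = 0 := by
      by_contra h0
      exact this (Finset.mem_filter.2 ⟨hφ, h0⟩)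
    rw [he φ hφ, h0, Nat.cast_zero, zero_smul]

end Clifford

section Quotient

variable {G Q : Type} [Group G] [Fintype G] [Group Q] {f : G →* Q}

lemma irrNot_apply_eq_zero (hf : Function.Surjective f) {r c : ℕ} [hr : Fact r.Prime]
    (hQ : Nat.card Q = r * c) (hrc : ¬ r ∣ c) (hc : c ∣ 24) {g : G} (hg : orderOf (f g) = r)
    (hgr : g ^ r = 1) (hgfix : ∀ n ∈ f.ker, n * g = g * n → n = 1)
    (hdeg : ∀ ψ₁ ∈ irrNot f.ker, ∀ ψ₂ ∈ irrNot f.ker, charDeg G ψ₁ = charDeg G ψ₂ → ψ₁ = ψ₂)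
    {ψ : G → ℂ} (hψ : ψ ∈ irrNot f.ker) {x : G} (hx : f x ≠ 1) : ψ x = 0 := by
  classical
  have : Finite Q := Finite.of_surjective f hf
  refine apply_eq_zero_of_relIndex_dvd hdeg (fun θ hθ hθ1 => ?_) hψ hx
  rw [Subgroup.relIndex_ker]
  have h1 := Subgroup.card_subgroup_dvd_card ((inertia f.ker θ).map f)
  rw [hQ] at h1
  refine (Nat.Coprime.dvd_of_dvd_mul_left ?_ h1).trans hc
  rw [Nat.coprime_comm, hr.out.coprime_iff_not_dvd]
  intro hdvd
  have hfac : (Nat.card Q).factorization r = 1 := by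
    have hc0 : c ≠ 0 := by rintro rfl; simp at hrc
    rw [hQ, Nat.factorization_mul hr.out.ne_zero hc0, Finsupp.add_apply,
      hr.out.factorization_self, Nat.factorization_eq_zero_of_not_dvd hrc]
  obtain ⟨w, t, ht, hw⟩ := exists_conj_mem_of_dvd hfac hg _ hdvd
  obtain ⟨w, rfl⟩ := hf w
  have hmem : w * g * w⁻¹ ∈ inertia f.ker θ := by
    have h2 : t⁻¹ * (w * g * w⁻¹) ∈ f.ker := by
      rw [MonoidHom.mem_ker]
      rw [map_mul, map_inv, hw]
      simp only [map_mul, map_inv]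
      exact inv_mul_cancel _
    have h3 : t⁻¹ * (w * g * w⁻¹) ∈ inertia f.ker θ :=
      conjChar_of_mem (isChar_of_mem_Irr hθ) h2
    simpa using (inertia f.ker θ).mul_mem ht h3
  refine hθ1 (eq_one_of_comp_eq (r := r) (k := 1) (MulAut.conjNormal (w * g * w⁻¹)) ?_ ?_ hθ
    fun n => congrFun hmem.out n)
  · rw [pow_one, ← map_pow, conj_pow, hgr]
    simp
  · intro n hn
    have h2 := congrArg Subtype.val hn
    rw [MulAut.conjNormal_apply] at h2
    have h3 : w⁻¹ * n * w = 1 := by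
      refine hgfix _ (by simpa using f.normal_ker.conj_mem n n.2 w⁻¹) ?_
      have h4 : g * (w⁻¹ * n * w) * g⁻¹ = w⁻¹ * n * w := by
        conv_rhs => rw [← h2]
        group
      exact (mul_inv_eq_iff_eq_mul.1 h4).symm
    have h5 : (n : G) = w * (w⁻¹ * n * w) * w⁻¹ := by group
    rw [h3] at h5
    exact Subtype.ext (by simpa using h5)

end Quotient
/-- The properties of the quotient group used in the argument. -/
structure QuotientData (Q : Type) [Group Q] (r c j k : ℕ) : Prop where
  simple : IsSimpleGroup Q
  card : Nat.card Q = r * c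
  exists_orderOf : ∃ g y : Q, orderOf g = r ∧ ¬ IsConj g (g ^ j) ∧ y * g * y⁻¹ = g ^ k ∧
    ∀ z, z * g = g * z → z ∈ Subgroup.zpowers g
  exists_order_three : ∃ u t : Q, u ≠ 1 ∧ u ^ 3 = 1 ∧ t * u * t⁻¹ = u⁻¹ ∧ t ^ 2 = 1 ∧
    ∀ z, z * u = u * z → z ∈ Subgroup.zpowers u

section PSL

open Matrix

variable {p : ℕ}

/-- The element of `SL(2, p)` with the given entries. -/
def sl (a b c d : ZMod p) (h : a * d - b * c = 1) : SpecialLinearGroup (Fin 2) (ZMod p) :=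
  ⟨!![a, b; c, d], by rwa [det_fin_two_of]⟩

lemma coe_sl (a b c d : ZMod p) (h : a * d - b * c = 1) :
    (sl a b c d h : Matrix (Fin 2) (Fin 2) (ZMod p)) = !![a, b; c, d] := rfl

lemma exists_eq_sl (A : SpecialLinearGroup (Fin 2) (ZMod p)) : ∃ a b c d h, A = sl a b c d h := by
  induction A using SpecialLinearGroup.fin_two_induction with
  | h a b c d h => exact ⟨a, b, c, d, h, rfl⟩

lemma sl_eq_sl {a b c d a' b' c' d' : ZMod p} {h h'} :
    sl a b c d h = sl a' b' c' d' h' ↔ a = a' ∧ b = b' ∧ c = c' ∧ d = d' := by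
  rw [Matrix.SpecialLinearGroup.ext_iff]
  simp [coe_sl, Fin.forall_fin_two, and_assoc]

lemma sl_mul {a b c d a' b' c' d' : ZMod p} {h h'} :
    sl a b c d h * sl a' b' c' d' h' =
      sl (a * a' + b * c') (a * b' + b * d') (c * a' + d * c') (c * b' + d * d')
        (by linear_combination h' + (a' * d' - b' * c') * h) := by
  ext i j
  fin_cases i <;> fin_cases j <;> simp [coe_sl]

lemma sl_one : (1 : SpecialLinearGroup (Fin 2) (ZMod p)) = sl 1 0 0 1 (by ring) := by
  ext i j
  fin_cases i <;> fin_cases j <;> simp [coe_sl]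

lemma sl_pow (n : ℕ) : sl (1 : ZMod p) 1 0 1 (by ring) ^ n = sl 1 n 0 1 (by ring) := by
  induction n with
  | zero => rw [pow_zero, sl_one, sl_eq_sl]; simp
  | succ n ih => rw [pow_succ, ih, sl_mul, sl_eq_sl]; simp [add_comm]

variable [hp : Fact p.Prime]

lemma mem_center_sl {a b c d : ZMod p} {h} :
    sl a b c d h ∈ Subgroup.center (SpecialLinearGroup (Fin 2) (ZMod p)) ↔
      (a = 1 ∧ b = 0 ∧ c = 0 ∧ d = 1) ∨ (a = -1 ∧ b = 0 ∧ c = 0 ∧ d = -1) := by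
  rw [Matrix.SpecialLinearGroup.mem_center_iff]
  constructor
  · rintro ⟨x, hx, hx'⟩
    have h1 (i j) := congrFun (congrFun hx' i) j
    have h2 := h1 0 0
    have h3 := h1 0 1
    have h4 := h1 1 0
    have h5 := h1 1 1
    simp [coe_sl] at h2 h3 h4 h5
    rw [Fintype.card_fin, sq_eq_one_iff] at hx
    rcases hx with rfl | rfl
    · exact Or.inl ⟨h2.symm, h3.symm, h4.symm, h5.symm⟩
    · exact Or.inr ⟨h2.symm, h3.symm, h4.symm, h5.symm⟩
  · rintro (⟨rfl, rfl, rfl, rfl⟩ | ⟨rfl, rfl, rfl, rfl⟩)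
    · refine ⟨1, by simp, ?_⟩
      ext i j
      fin_cases i <;> fin_cases j <;> simp [coe_sl]
    · refine ⟨-1, by simp, ?_⟩
      ext i j
      fin_cases i <;> fin_cases j <;> simp [coe_sl]

/-- The class of a matrix in `PSL(2, p)`. -/
def psl (a b c d : ZMod p) (h : a * d - b * c = 1) : PSL2 p := QuotientGroup.mk (sl a b c d h)

lemma exists_eq_psl (x : PSL2 p) : ∃ a b c d h, x = psl a b c d h := by
  obtain ⟨A, rfl⟩ := QuotientGroup.mk_surjective x
  obtain ⟨a, b, c, d, h, rfl⟩ := exists_eq_sl A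
  exact ⟨a, b, c, d, h, rfl⟩

lemma psl_mul {a b c d a' b' c' d' : ZMod p} {h h'} :
    psl a b c d h * psl a' b' c' d' h' =
      psl (a * a' + b * c') (a * b' + b * d') (c * a' + d * c') (c * b' + d * d')
        (by linear_combination h' + (a' * d' - b' * c') * h) := by
  rw [psl, psl, psl, ← sl_mul]
  rfl

lemma psl_one : (1 : PSL2 p) = psl 1 0 0 1 (by ring) := by
  rw [psl, ← sl_one]
  rfl

lemma psl_pow (n : ℕ) : psl (1 : ZMod p) 1 0 1 (by ring) ^ n = psl 1 n 0 1 (by ring) := by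
  rw [psl, psl, ← sl_pow]
  rfl

lemma psl_eq_psl {a b c d a' b' c' d' : ZMod p} {h h'} :
    psl a b c d h = psl a' b' c' d' h' ↔ (a = a' ∧ b = b' ∧ c = c' ∧ d = d') ∨
      (a = -a' ∧ b = -b' ∧ c = -c' ∧ d = -d') := by
  have hneg : psl (-a') (-b') (-c') (-d') (by linear_combination h') = psl a' b' c' d' h' := by
    rw [psl, psl, QuotientGroup.eq]
    have : (sl (-a') (-b') (-c') (-d') (by linear_combination h'))⁻¹ * sl a' b' c' d' h' =
        sl (-1) 0 0 (-1) (by ring) := by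
      rw [inv_mul_eq_iff_eq_mul, sl_mul, sl_eq_sl]
      simp
    rw [this, mem_center_sl]
    simp
  constructor
  · intro hh
    rw [psl, psl, QuotientGroup.eq] at hh
    obtain ⟨x, y, z, w, hx, hx'⟩ := exists_eq_sl ((sl a b c d h)⁻¹ * sl a' b' c' d' h')
    rw [hx', mem_center_sl] at hh
    rw [inv_mul_eq_iff_eq_mul, sl_mul, sl_eq_sl] at hx'
    rcases hh with ⟨rfl, rfl, rfl, rfl⟩ | ⟨rfl, rfl, rfl, rfl⟩
    · left; simp at hx'; simp [hx']
    · right; simp at hx'; simp [hx']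
  · rintro (⟨rfl, rfl, rfl, rfl⟩ | ⟨rfl, rfl, rfl, rfl⟩)
    · rfl
    · exact hneg

lemma card_PSL2 (hp2 : (1 : ZMod p) ≠ -1) {n : ℕ} (hn : (Finset.univ.filter
    fun x : ZMod p × ZMod p × ZMod p × ZMod p => x.1 * x.2.2.2 - x.2.1 * x.2.2.1 = 1).card =
      n * 2) : Nat.card (PSL2 p) = n := by
  classical
  have h1 : Nat.card (SpecialLinearGroup (Fin 2) (ZMod p)) = n * 2 := by
    rw [← hn, ← Fintype.card_subtype, ← Nat.card_eq_fintype_card]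
    refine (Nat.card_congr (Equiv.ofBijective (fun x => sl x.1.1 x.1.2.1 x.1.2.2.1 x.1.2.2.2 x.2)
      ⟨?_, ?_⟩)).symm
    · rintro ⟨⟨a, b, c, d⟩, h⟩ ⟨⟨a', b', c', d'⟩, h'⟩ hh
      simpa [sl_eq_sl] using hh
    · intro A
      obtain ⟨a, b, c, d, h, rfl⟩ := exists_eq_sl A
      exact ⟨⟨(a, b, c, d), h⟩, rfl⟩
  have h2 : Nat.card (Subgroup.center (SpecialLinearGroup (Fin 2) (ZMod p))) = 2 := by
    have h3 : (Subgroup.center (SpecialLinearGroup (Fin 2) (ZMod p)) :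
        Set (SpecialLinearGroup (Fin 2) (ZMod p))) =
        {sl 1 0 0 1 (by ring), sl (-1) 0 0 (-1) (by ring)} := by
      ext A
      obtain ⟨a, b, c, d, h, rfl⟩ := exists_eq_sl A
      rw [SetLike.mem_coe, mem_center_sl, Set.mem_insert_iff, Set.mem_singleton_iff, sl_eq_sl,
        sl_eq_sl]
    rw [← SetLike.coe_sort_coe, Nat.card_coe_set_eq, h3, Set.ncard_pair]
    rw [Ne, sl_eq_sl]
    exact fun h => hp2 h.1
  have h4 := Subgroup.card_eq_card_quotient_mul_card_subgroup
    (Subgroup.center (SpecialLinearGroup (Fin 2) (ZMod p)))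
  rw [h1, h2] at h4
  exact (Nat.eq_of_mul_eq_mul_right two_pos h4).symm

lemma quotientData_PSL2 {c j k : ℕ} (hp4 : 4 ≤ p) (hp2 : (1 : ZMod p) ≠ -1)
    (hn : (Finset.univ.filter fun x : ZMod p × ZMod p × ZMod p × ZMod p =>
      x.1 * x.2.2.2 - x.2.1 * x.2.2.1 = 1).card = p * c * 2)
    (hj : ∀ a b c d : ZMod p, a * d - b * c = 1 →
      ¬ ((a * 1 + b * 0 = 1 * a + j * c ∧ a * 1 + b * 1 = 1 * b + j * d ∧
          c * 1 + d * 0 = 0 * a + 1 * c ∧ c * 1 + d * 1 = 0 * b + 1 * d) ∨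
        (a * 1 + b * 0 = -(1 * a + j * c) ∧ a * 1 + b * 1 = -(1 * b + j * d) ∧
          c * 1 + d * 0 = -(0 * a + 1 * c) ∧ c * 1 + d * 1 = -(0 * b + 1 * d))))
    {s s' : ZMod p} (hs : s * s' - 0 * 0 = 1) (hsk : s = k * s')
    (hg : ∀ a b c d : ZMod p, a * d - b * c = 1 →
      ((a * 1 + b * 0 = 1 * a + 1 * c ∧ a * 1 + b * 1 = 1 * b + 1 * d ∧
          c * 1 + d * 0 = 0 * a + 1 * c ∧ c * 1 + d * 1 = 0 * b + 1 * d) ∨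
        (a * 1 + b * 0 = -(1 * a + 1 * c) ∧ a * 1 + b * 1 = -(1 * b + 1 * d) ∧
          c * 1 + d * 0 = -(0 * a + 1 * c) ∧ c * 1 + d * 1 = -(0 * b + 1 * d))) →
      (a = 1 ∧ c = 0 ∧ d = 1) ∨ (a = -1 ∧ c = 0 ∧ d = -1))
    (ht : ∃ t : PSL2 p, t * psl 0 (-1) 1 (-1) (by ring) = psl (-1) 1 (-1) 0 (by ring) * t ∧ t * t = 1)
    (hu : ∀ a b c d : ZMod p, a * d - b * c = 1 →
      ((a * 0 + b * 1 = 0 * a + -1 * c ∧ a * -1 + b * -1 = 0 * b + -1 * d ∧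
          c * 0 + d * 1 = 1 * a + -1 * c ∧ c * -1 + d * -1 = 1 * b + -1 * d) ∨
        (a * 0 + b * 1 = -(0 * a + -1 * c) ∧ a * -1 + b * -1 = -(0 * b + -1 * d) ∧
          c * 0 + d * 1 = -(1 * a + -1 * c) ∧ c * -1 + d * -1 = -(1 * b + -1 * d))) →
      ((a = 1 ∧ b = 0 ∧ c = 0 ∧ d = 1) ∨ (a = -1 ∧ b = -0 ∧ c = -0 ∧ d = -1)) ∨
      ((a = 0 ∧ b = -1 ∧ c = 1 ∧ d = -1) ∨ (a = -0 ∧ b = - -1 ∧ c = -1 ∧ d = - -1)) ∨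
      ((a = -1 ∧ b = 1 ∧ c = -1 ∧ d = 0) ∨ (a = - -1 ∧ b = -1 ∧ c = - -1 ∧ d = -0))) :
    QuotientData (PSL2 p) p c j k where
  simple := Matrix.ProjectiveSpecialLinearGroup.rank_two_simple (by simpa using hp4)
  card := card_PSL2 hp2 hn
  exists_orderOf := by
    refine ⟨psl 1 1 0 1 (by ring), psl s 0 0 s' hs, ?_, ?_, ?_, ?_⟩
    · refine orderOf_eq_prime ?_ ?_
      · rw [psl_pow, psl_one, psl_eq_psl]
        simp
      · rw [psl_one, Ne, psl_eq_psl]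
        simp [hp2]
    · rw [isConj_iff]
      rintro ⟨z, hz⟩
      obtain ⟨a, b, c, d, h, rfl⟩ := exists_eq_psl z
      rw [mul_inv_eq_iff_eq_mul, psl_pow, psl_mul, psl_mul, psl_eq_psl] at hz
      exact hj a b c d h hz
    · rw [mul_inv_eq_iff_eq_mul, psl_pow, psl_mul, psl_mul, psl_eq_psl]
      left
      simpa using hsk
    · intro z hz
      obtain ⟨a, b, c, d, h, rfl⟩ := exists_eq_psl z
      rw [psl_mul, psl_mul, psl_eq_psl] at hz
      rcases hg a b c d h hz with ⟨rfl, rfl, rfl⟩ | ⟨rfl, rfl, rfl⟩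
      · refine ⟨(b.val : ℕ), ?_⟩
        simp only [zpow_natCast]
        rw [psl_pow, psl_eq_psl]
        simp
      · refine ⟨((-b).val : ℕ), ?_⟩
        simp only [zpow_natCast]
        rw [psl_pow, psl_eq_psl]
        simp
  exists_order_three := by
    obtain ⟨t, htu, ht2⟩ := ht
    set u : PSL2 p := psl 0 (-1) 1 (-1) (by ring) with hudef
    have huu : u * u = psl (-1) 1 (-1) 0 (by ring) := by
      rw [hudef, psl_mul, psl_eq_psl]
      simp
    have hu3 : u * (u * u) = 1 := by
      rw [huu, hudef, psl_mul, psl_one, psl_eq_psl]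
      simp
    refine ⟨u, t, ?_, ?_, ?_, ?_, ?_⟩
    · rw [hudef, psl_one, Ne, psl_eq_psl]
      simp
    · rw [pow_succ, pow_two, mul_assoc, hu3]
    · rw [mul_inv_eq_iff_eq_mul, htu, ← huu, eq_inv_of_mul_eq_one_right hu3]
    · rw [pow_two, ht2]
    · intro z hz
      obtain ⟨a, b, c, d, h, rfl⟩ := exists_eq_psl z
      rw [hudef, psl_mul, psl_mul, psl_eq_psl] at hz
      rcases hu a b c d h hz with h1 | h1 | h1
      · rw [← psl_eq_psl (h := h) (h' := by ring), ← psl_one] at h1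
        rw [h1]
        exact one_mem _
      · rw [← psl_eq_psl (h := h) (h' := by ring), ← hudef] at h1
        rw [h1]
        exact Subgroup.mem_zpowers u
      · rw [← psl_eq_psl (h := h) (h' := by ring), ← huu] at h1
        rw [h1]
        exact mul_mem (Subgroup.mem_zpowers u) (Subgroup.mem_zpowers u)

end PSL

instance fact_prime_five : Fact (Nat.Prime 5) := ⟨by norm_num⟩

instance fact_prime_seven : Fact (Nat.Prime 7) := ⟨by norm_num⟩

set_option synthInstance.maxSize 1000 in
set_option synthInstance.maxHeartbeats 200000 in
lemma quotientData_five : QuotientData (PSL2 5) 5 12 2 4 := by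
  refine quotientData_PSL2 (s := 2) (s' := 3) (by norm_num) (by decide) (by decide +kernel)
    (by decide +kernel) (by decide) (by decide) (by decide +kernel)
    ⟨psl 0 2 2 0 (by decide), ?_, ?_⟩ (by decide +kernel)
  · rw [psl_mul, psl_mul, psl_eq_psl]
    decide
  · rw [psl_mul, psl_one, psl_eq_psl]
    decide

set_option synthInstance.maxSize 1000 in
set_option synthInstance.maxHeartbeats 200000 in
lemma quotientData_seven : QuotientData (PSL2 7) 7 24 6 2 := by
  refine quotientData_PSL2 (s := 3) (s' := 5) (by norm_num) (by decide) (by decide +kernel)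
    (by decide +kernel) (by decide) (by decide) (by decide +kernel)
    ⟨psl 1 3 4 6 (by decide), ?_, ?_⟩ (by decide +kernel)
  · rw [psl_mul, psl_mul, psl_eq_psl]
    decide
  · rw [psl_mul, psl_one, psl_eq_psl]
    decide

section Codegrees

variable {G : Type} [Group G]

lemma charDeg_mul {χ φ : G → ℂ} (h : IsChar χ) (h' : IsChar φ) :
    charDeg G (χ * φ) = charDeg G χ * charDeg G φ := by
  have h1 := (h.mul h').charDeg_eq
  rw [Pi.mul_apply, ← h.charDeg_eq, ← h'.charDeg_eq] at h1
  exact_mod_cast h1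

variable [Fintype G]

lemma cod_mul_charDeg {χ : G → ℂ} (h : χ ∈ Irr G) {K : Subgroup G}
    (hK : (K : Set G) = kerSet G χ) : cod G χ * charDeg G χ = K.index := by
  have h1 : Fintype.card G / (kerSet G χ).ncard = K.index := by
    have h3 : (kerSet G χ).ncard = Nat.card K := by
      rw [← hK, ← Nat.card_coe_set_eq, SetLike.coe_sort_coe]
    rw [h3, ← Nat.card_eq_fintype_card, ← K.index_mul_card, Nat.mul_div_cancel _ Nat.card_pos]
  rw [cod, h1, Nat.div_mul_cancel (charDeg_dvd_index h hK)]

/-- All repeated codegrees of a `T'_k`-group coincide. -/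
lemma exists_cod_eq_of_ne {k : ℕ} (h : IsTk' G k) : ∃ d₀, ∀ χ₁ ∈ Irr G, ∀ χ₂ ∈ Irr G,
    cod G χ₁ = cod G χ₂ → χ₁ ≠ χ₂ → cod G χ₁ = d₀ := by
  obtain ⟨d₀, -, -, hd⟩ := h
  refine ⟨d₀, fun χ₁ h₁ χ₂ h₂ heq hne => ?_⟩
  by_contra hc
  obtain ⟨χ, hχ⟩ := Set.ncard_eq_one.1 (hd _ ⟨χ₁, h₁, rfl⟩ hc)
  have e₁ : χ₁ ∈ ({χ} : Set (G → ℂ)) := hχ ▸ ⟨h₁, rfl⟩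
  have e₂ : χ₂ ∈ ({χ} : Set (G → ℂ)) := hχ ▸ ⟨h₂, heq.symm⟩
  exact hne (e₁.trans e₂.symm)

lemma eq_one_of_kerSet_eq_univ {χ : G → ℂ} (h : χ ∈ Irr G) (hk : ∀ x, x ∈ kerSet G χ) : χ = 1 := by
  by_contra h1
  have h2 := sum_eq_zero_of_ne_one h h1
  rw [Finset.sum_congr rfl fun x _ => hk x, Finset.sum_const, nsmul_eq_mul, mul_eq_zero] at h2
  refine h2.elim ?_ (apply_one_ne_zero h)
  rw [Finset.card_univ, ← Nat.card_eq_fintype_card]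
  exact card_ne_zero

/-- The product of irreducible characters trivial on the two factors of a direct product. -/
lemma mul_mem_Irr_of_isComplement {K M : Subgroup G} (hKM : K.IsComplement' M)
    {χ ψ : G → ℂ} (hχ : χ ∈ irrOver M) (hψ : ψ ∈ irrOver K) : χ * ψ ∈ Irr G := by
  classical
  rw [mem_irrOver] at hχ hψ
  have hχ' := isChar_of_mem_Irr hχ.1
  have hψ' := isChar_of_mem_Irr hψ.1
  refine mem_Irr_iff.2 ⟨hχ'.mul hψ', ?_⟩
  have hl {φ : G → ℂ} {N : Subgroup G} (hφ : IsChar φ) (hN : (N : Set G) ⊆ kerSet G φ) {n : G}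
      (hn : n ∈ N) (x : G) : φ (n * x) = φ x := by
    rw [← hφ.conj _ n⁻¹, ← hφ.mul_of_mem_kerSet (x := x) (hN hn)]
    congr 1
    group
  have hM (x : G) (n : M) : χ (x * n) = χ x := hχ'.mul_of_mem_kerSet (hχ.2 n.2)
  have hM' (x : G) (n : M) : χ (x * n)⁻¹ = χ x⁻¹ := by
    rw [mul_inv_rev, hl hχ' hχ.2 (M.inv_mem n.2)]
  have hK (x : G) (n : K) : ψ (n * x) = ψ x := hl hψ' hψ.2 n.2 x
  have hK' (x : G) (n : K) : ψ (n * x)⁻¹ = ψ x⁻¹ := by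
    rw [mul_inv_rev, hψ'.mul_of_mem_kerSet (hψ.2 (K.inv_mem n.2))]
  have key (F : G → ℂ) : ∑ x, F x = ∑ k : K, ∑ m : M, F (k * m) := by
    rw [← Fintype.sum_prod_type' (f := fun (k : K) (m : M) => F (k * m))]
    exact (Function.Bijective.sum_comp hKM F).symm
  have hcard : (Nat.card G : ℂ) = Nat.card K * Nat.card M := by
    exact_mod_cast hKM.card_mul_card.symm
  have h1 := charInner_self hχ.1
  have h2 := charInner_self hψ.1
  rw [charInner, inv_mul_eq_one₀ card_ne_zero, key] at h1 h2 ⊢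
  simp only [hM, hM', Finset.sum_const, Finset.card_univ, ← Nat.card_eq_fintype_card, nsmul_eq_mul,
    ← Finset.mul_sum] at h1
  simp only [hK, hK', Finset.sum_const, Finset.card_univ, ← Nat.card_eq_fintype_card,
    nsmul_eq_mul] at h2
  have h3 : ∑ k : K, ∑ m : M, (χ * ψ) (k * m) * (χ * ψ) (k * m : G)⁻¹ =
      (∑ k : K, χ k * χ (k : G)⁻¹) * ∑ m : M, ψ m * ψ (m : G)⁻¹ := by
    rw [Finset.sum_mul_sum]
    refine Finset.sum_congr rfl fun k _ => Finset.sum_congr rfl fun m _ => ?_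
    rw [Pi.mul_apply, Pi.mul_apply, hM, hM', hK, hK']
    ring
  rw [h3]
  refine mul_left_cancel₀ (card_ne_zero (G := G)) ?_
  calc _ = (Nat.card G : ℂ) * Nat.card G := by rw []
    _ = (Nat.card M * ∑ k : K, χ k * χ (k : G)⁻¹) *
      (Nat.card K * ∑ m : M, ψ m * ψ (m : G)⁻¹) := by rw [← h1, ← h2]
    _ = _ := by rw [hcard]; ring

end Codegrees

section Quotient

variable {G Q : Type} [Group G] [Group Q] {f : G →* Q}

lemma le_ker_or_sup_eq_top (hf : Function.Surjective f) (hQ : IsSimpleGroup Q) (K : Subgroup G)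
    [hK : K.Normal] : K ≤ f.ker ∨ K ⊔ f.ker = ⊤ := by
  rcases (hK.map f hf).eq_bot_or_eq_top with h | h
  · exact Or.inl ((Subgroup.map_eq_bot_iff K).1 h)
  · right
    rw [← Subgroup.comap_map_eq, h, Subgroup.comap_top]

lemma exists_mem_map_eq {K : Subgroup G} (hK : K ⊔ f.ker = ⊤) (x : G) : ∃ y ∈ K, f y = f x := by
  have hx : x ∈ K ⊔ f.ker := hK ▸ Subgroup.mem_top x
  obtain ⟨y, hy, z, hz, rfl⟩ := Subgroup.mem_sup_of_normal_right.1 hx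
  exact ⟨y, hy, by rw [map_mul, MonoidHom.mem_ker.1 hz, mul_one]⟩

lemma index_ker (hf : Function.Surjective f) : f.ker.index = Nat.card Q := by
  rw [Subgroup.index_ker, MonoidHom.range_eq_top.2 hf, Subgroup.card_top]

lemma eq_one_of_forall_commute (hQ : IsSimpleGroup Q) {u t : Q} (hu : u ≠ 1) (hu3 : u ^ 3 = 1)
    (ht : t * u * t⁻¹ = u⁻¹) {z : Q} (hz : ∀ w, z * w = w * z) : z = 1 := by
  rcases (inferInstance : (Subgroup.center Q).Normal).eq_bot_or_eq_top with h | h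
  · rw [← Subgroup.mem_bot, ← h, Subgroup.mem_center_iff]
    exact fun w => (hz w).symm
  · have h1 : t * u = u * t := (Subgroup.mem_center_iff.1 (h ▸ Subgroup.mem_top u)) t
    rw [h1, mul_inv_cancel_right] at ht
    have h2 : u * u = 1 := by
      nth_rw 2 [ht]
      exact mul_inv_cancel u
    rw [pow_succ, pow_two, h2, one_mul] at hu3
    exact absurd hu3 hu

variable [Fintype G]

lemma kerSet_eq_ker (hf : Function.Surjective f) (hQ : IsSimpleGroup Q) {χ : G → ℂ}
    (hχ : χ ∈ irrOver f.ker) (h1 : χ ≠ 1) : (f.ker : Set G) = kerSet G χ := by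
  rw [mem_irrOver] at hχ
  obtain ⟨K, hK, hKχ⟩ := (isChar_of_mem_Irr hχ.1).exists_ker
  rcases le_ker_or_sup_eq_top hf hQ K with h | h
  · exact hχ.2.antisymm (hKχ ▸ h)
  · refine absurd (eq_one_of_kerSet_eq_univ hχ.1 fun x => ?_) h1
    rw [← hKχ] at hχ ⊢
    rw [sup_eq_left.2 (SetLike.coe_subset_coe.1 hχ.2)] at h
    exact h ▸ Subgroup.mem_top x

/-- The hypotheses on the group extension used throughout the argument: `f` is a surjection onto
a simple group with trivial center whose kernel is a minimal normal subgroup, all repeated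
codegrees are `d₀`, and `χ` is a character of the quotient moved by `σ` at `g`. -/
structure Extension (f : G →* Q) (d₀ : ℕ) (σ : ℂ →+* ℂ) (χ : G → ℂ) (g : G) : Prop where
  surj : Function.Surjective f
  simple : IsSimpleGroup Q
  center : ∀ z : Q, (∀ w, z * w = w * z) → z = 1
  ne_bot : f.ker ≠ ⊥
  minimal : ∀ N : Subgroup G, N.Normal → N ≤ f.ker → N = ⊥ ∨ N = f.ker
  cod_eq : ∀ χ₁ ∈ Irr G, ∀ χ₂ ∈ Irr G, cod G χ₁ = cod G χ₂ → χ₁ ≠ χ₂ → cod G χ₁ = d₀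
  mem : χ ∈ irrOver f.ker
  map_ne : σ (χ g) ≠ χ g

namespace Extension

variable {d₀ : ℕ} {σ : ℂ →+* ℂ} {χ : G → ℂ} {g : G}

lemma finite (E : Extension f d₀ σ χ g) : Finite Q := Finite.of_surjective f E.surj

lemma cod_eq_of_map_ne (E : Extension f d₀ σ χ g) {φ : G → ℂ} (hφ : φ ∈ Irr G)
    (τ : ℂ →+* ℂ) {x : G} (hx : τ (φ x) ≠ φ x) :
    cod G φ = d₀ :=
  E.cod_eq φ hφ _ (map_mem_Irr hφ τ) ((isChar_of_mem_Irr hφ).cod_map τ).symm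
    fun h => hx (congrFun h x).symm

lemma ne_one (E : Extension f d₀ σ χ g) : χ ≠ 1 := fun h => E.map_ne (by rw [h]; simp)

lemma kerSet_eq (E : Extension f d₀ σ χ g) : (f.ker : Set G) = kerSet G χ := kerSet_eq_ker E.surj E.simple E.mem E.ne_one

lemma cod_mul (E : Extension f d₀ σ χ g) : d₀ * charDeg G χ = Nat.card Q := by
  rw [← E.cod_eq_of_map_ne (mem_irrOver.1 E.mem).1 σ E.map_ne,
    cod_mul_charDeg (mem_irrOver.1 E.mem).1 E.kerSet_eq, index_ker E.surj]

/-- The kernel of `f` has no normal complement. -/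
lemma not_complement (E : Extension f d₀ σ χ g) (K : Subgroup G) [hK : K.Normal]
    (hbot : K ⊓ f.ker = ⊥)
    (htop : K ⊔ f.ker = ⊤) : False := by
  have := E.finite
  have hcompl : K.IsComplement' f.ker := by
    refine Subgroup.isComplement'_of_disjoint_and_mul_eq_univ (disjoint_iff.2 hbot) ?_
    rw [← Subgroup.mul_normal, htop, Subgroup.coe_top]
  have hKtop : K ≠ ⊤ := by
    rintro rfl
    exact E.ne_bot (by simpa using hbot)
  obtain ⟨ψ, hψ, hψ1⟩ := exists_irrOver_ne_one K hKtop
  have hφ := mul_mem_Irr_of_isComplement hcompl E.mem hψ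
  have hχ' := mem_irrOver.1 E.mem
  have hψ' := mem_irrOver.1 hψ
  have hχc := isChar_of_mem_Irr hχ'.1
  have hψc := isChar_of_mem_Irr hψ'.1
  have hcod : cod G (χ * ψ) = d₀ := by
    obtain ⟨y, hy, hfy⟩ := exists_mem_map_eq htop g
    refine E.cod_eq_of_map_ne hφ σ (x := y) ?_
    have h1 : χ y = χ g := by
      rw [← hχc.mul_of_mem_kerSet (x := g) (hχ'.2 (show g⁻¹ * y ∈ f.ker by
        rw [MonoidHom.mem_ker, map_mul, map_inv, hfy, inv_mul_cancel])), mul_inv_cancel_left]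
    rw [Pi.mul_apply, h1, hψ'.2 hy, map_mul, ← hψc.charDeg_eq, map_natCast, hψc.charDeg_eq]
    exact fun h => E.map_ne (mul_right_cancel₀ (apply_one_ne_zero hψ'.1) h)
  obtain ⟨N, hN, hNφ⟩ := (isChar_of_mem_Irr hφ).exists_ker
  obtain ⟨L, hL, hLψ⟩ := hψc.exists_ker
  have hNM : Disjoint N f.ker := by
    have hLM : L ⊓ f.ker = ⊥ := by
      refine (E.minimal (L ⊓ f.ker) inferInstance inf_le_right).resolve_right fun h => ?_
      refine hψ1 (eq_one_of_kerSet_eq_univ hψ'.1 fun x => ?_)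
      rw [← hLψ] at hψ' ⊢
      exact (top_le_iff.1 (htop ▸ sup_le (SetLike.coe_subset_coe.1 hψ'.2) (inf_eq_right.1 h))) ▸ Subgroup.mem_top x
    rw [Subgroup.disjoint_def]
    intro x hx hxM
    rw [← Subgroup.mem_bot, ← hLM]
    refine ⟨?_, hxM⟩
    have h1 : x ∈ kerSet G (χ * ψ) := hNφ ▸ hx
    have h2 : χ x * ψ x = χ 1 * ψ 1 := h1
    rw [hχ'.2 hxM] at h2
    change x ∈ (L : Set G)
    rw [hLψ]
    exact mul_left_cancel₀ (apply_one_ne_zero hχ'.1) h2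
  have hNK : Disjoint N K := by
    rw [Subgroup.disjoint_def]
    intro x hx hxK
    rw [← Subgroup.mem_bot, ← hbot]
    refine ⟨hxK, ?_⟩
    have h1 : x ∈ kerSet G (χ * ψ) := hNφ ▸ hx
    have h2 : χ x * ψ x = χ 1 * ψ 1 := h1
    rw [hψ'.2 hxK] at h2
    change x ∈ (f.ker : Set G)
    rw [E.kerSet_eq]
    exact mul_right_cancel₀ (apply_one_ne_zero hψ'.1) h2
  have hNbot : N = ⊥ := by
    rw [eq_bot_iff, ← hNM.eq_bot]
    refine le_inf le_rfl fun x hx => MonoidHom.mem_ker.2 (E.center _ fun w => ?_)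
    obtain ⟨w, rfl⟩ := E.surj w
    obtain ⟨y, hy, hfy⟩ := exists_mem_map_eq htop w
    rw [← hfy, ← map_mul, ← map_mul]
    exact congrArg f (Subgroup.commute_of_normal_of_disjoint N K hN hK hNK x y hx hy)
  have h1 := cod_mul_charDeg hφ hNφ
  have h2 := f.ker.index_mul_card
  have h4 := sum_irrOver_sq K
  rw [← hcompl.card_mul_card] at h4
  have h5 := Nat.eq_of_mul_eq_mul_left Nat.card_pos h4
  rw [hcod, hNbot, Subgroup.index_bot, charDeg_mul hχc hψc, ← mul_assoc, E.cod_mul, ← h2,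
    index_ker E.surj] at h1
  have h6 := Nat.eq_of_mul_eq_mul_left Nat.card_pos h1
  have h7 : ∑ χ ∈ {ψ, 1}, charDeg G χ ^ 2 ≤ ∑ χ ∈ irrOver K, charDeg G χ ^ 2 := by
    refine Finset.sum_le_sum_of_subset fun φ hφ => ?_
    rcases Finset.mem_insert.1 hφ with rfl | h
    · exact hψ
    · rw [Finset.mem_singleton.1 h, mem_irrOver]
      exact ⟨one_mem_Irr, fun x _ => rfl⟩
  rw [Finset.sum_pair hψ1, h5, h6] at h7
  have h8 := charDeg_pos (one_mem_Irr (G := G))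
  nlinarith [Nat.card_pos (α := f.ker)]

end Extension
end Quotient
section Orbits

variable {H : Type} [Group H]

lemma subtypePerm_pow_eq_one {σ : MulAut H} {n : ℕ} (hσ : σ ^ n = 1) {p : H → Prop}
    (hp : ∀ x, p (σ.toEquiv x) ↔ p x) : (Equiv.Perm.subtypePerm σ.toEquiv hp) ^ n = 1 := by
  ext x
  have h (n : ℕ) (x : {x : H // p x}) :
      (((Equiv.Perm.subtypePerm σ.toEquiv hp) ^ n) x : H) = (σ ^ n) x := by
    induction n generalizing x with
    | zero => simp
    | succ n ih =>
      rw [pow_succ, pow_succ, Equiv.Perm.mul_apply, ih]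
      rfl
  rw [h, hσ]
  rfl

variable [Fintype H] {r k : ℕ} [hr : Fact r.Prime]

/-- A nontrivial automorphism of `r`-power order moves a positive multiple of `r` elements. -/
lemma exists_card_moved {σ : MulAut H} (hσ : σ ^ r ^ k = 1) (hne : σ ≠ 1) :
    r ≤ Nat.card {x // σ x ≠ x} := by
  classical
  obtain ⟨x, hx⟩ : ∃ x, σ x ≠ x := by
    by_contra! hc
    exact hne (MulEquiv.ext hc)
  have hp : ∀ x, σ (σ.toEquiv x) ≠ σ.toEquiv x ↔ σ x ≠ x := fun x => by simp
  have h1 := dvd_card_of_forall_ne _ (subtypePerm_pow_eq_one (p := fun x => σ x ≠ x) hσ hp) fun x hx =>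
    x.2 (congrArg Subtype.val hx)
  rw [← Nat.card_eq_fintype_card] at h1
  have : Nonempty {x // σ x ≠ x} := ⟨⟨x, hx⟩⟩
  exact Nat.le_of_dvd Nat.card_pos h1

lemma le_card_of_mulAut_ne_one {σ : MulAut H} (hσ : σ ^ r ^ k = 1) (hne : σ ≠ 1) :
    r + 1 ≤ Nat.card H := by
  classical
  refine Nat.succ_le_of_lt ((exists_card_moved hσ hne).trans_lt ?_)
  rw [Nat.card_eq_fintype_card, Nat.card_eq_fintype_card]
  exact Fintype.card_subtype_lt (x := 1) (by simp)

lemma dvd_of_sum_eq_zero {σ : MulAut H} (hσ : σ ^ r ^ k = 1) (hne : σ ≠ 1)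
    (hcard : Nat.card H = r + 1) {F : H → ℂ} (hF : ∀ x, F (σ x) = F x)
    (hint : ∀ x, IsIntegral ℤ (F x)) (hsum : ∑ x, F x = 0) {n : ℕ} (hn : F 1 = n) : r ∣ n := by
  classical
  have hfix : ∀ x, σ x = x → x = 1 := by
    by_contra! hc
    obtain ⟨x, hx, hx1⟩ := hc
    have h1 := exists_card_moved hσ hne
    rw [Nat.card_eq_fintype_card, Fintype.card_subtype] at h1
    have h2 : (Finset.univ.filter fun x => σ x ≠ x) ⊆ (Finset.univ.erase 1).erase x := by
      intro y hy
      have hy := (Finset.mem_filter.1 hy).2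
      refine Finset.mem_erase.2 ⟨?_, Finset.mem_erase.2 ⟨?_, Finset.mem_univ _⟩⟩
      · rintro rfl; exact hy hx
      · rintro rfl; exact hy (map_one σ)
    have h3 := Finset.card_le_card h2
    rw [Finset.card_erase_of_mem (Finset.mem_erase.2 ⟨hx1, Finset.mem_univ _⟩),
      Finset.card_erase_of_mem (Finset.mem_univ _), Finset.card_univ, ← Nat.card_eq_fintype_card,
      hcard] at h3
    have := hr.out.pos
    omega
  have hp : ∀ x, σ.toEquiv x ≠ 1 ↔ x ≠ 1 := fun x => by simp
  obtain ⟨α, hα, h⟩ := exists_sum_eq_mul_isIntegral (F := fun x : {x : H // x ≠ 1} => F x) _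
    (subtypePerm_pow_eq_one (p := fun x => x ≠ 1) hσ hp) (fun x hx => x.2 (hfix x (congrArg Subtype.val hx)))
    (fun x => hF x) (fun x => hint x)
  rw [← Fintype.sum_subtype_add_sum_subtype (fun x => x = 1) F] at hsum
  have h1 : ((default : {x : H // x = 1}) : H) = 1 := rfl
  have h2 : F 1 + r * α = 0 := by
    rw [← h, ← hsum]
    simp [h1]
  refine dvd_of_eq_mul_isIntegral hr.out.ne_zero hα.neg ?_
  rw [← hn]
  linear_combination h2

end Orbits

/-- If the kernel contains its centralizer, then an element of order `r` of the quotient acts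
nontrivially on it. -/
lemma exists_conjNormal_ne_one {G Q : Type} [Group G] [Finite G] [Group Q] {f : G →* Q} {g : G}
    {r : ℕ} [hr : Fact r.Prime] (hg : orderOf (f g) = r)
    (hC : Subgroup.centralizer (f.ker : Set G) ≤ f.ker) :
    ∃ (x : G) (k : ℕ), (MulAut.conjNormal x : MulAut f.ker) ^ r ^ k = 1 ∧
      (MulAut.conjNormal x : MulAut f.ker) ≠ 1 := by
  obtain ⟨k, s, hs, hks⟩ := Nat.exists_eq_pow_mul_and_not_dvd (orderOf_pos g).ne' r hr.out.ne_one
  refine ⟨g ^ s, k, ?_, fun h => ?_⟩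
  · rw [← map_pow, ← pow_mul, mul_comm s, ← hks, pow_orderOf_eq_one, map_one]
  · have h1 : g ^ s ∈ Subgroup.centralizer (f.ker : Set G) := by
      rw [Subgroup.mem_centralizer_iff]
      intro n hn
      have h2 := congrArg Subtype.val (DFunLike.congr_fun h ⟨n, hn⟩)
      rw [MulAut.conjNormal_apply, mul_inv_eq_iff_eq_mul] at h2
      exact h2.symm
    have h2 := MonoidHom.mem_ker.1 (hC h1)
    rw [map_pow] at h2
    exact hs (hg ▸ orderOf_dvd_of_pow_eq_one h2)

namespace Extension

variable {G Q : Type} [Group G] [Group Q] {f : G →* Q} [Fintype G]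
variable {d₀ : ℕ} {σ : ℂ →+* ℂ} {χ : G → ℂ} {g : G}

/-- The irreducible characters that do not contain the kernel of `f` in their kernel are
faithful. -/
lemma kerSet_eq_bot (E : Extension f d₀ σ χ g) {ψ : G → ℂ} (hψ : ψ ∈ irrNot f.ker) :
    ((⊥ : Subgroup G) : Set G) = kerSet G ψ := by
  rw [mem_irrNot] at hψ
  obtain ⟨K, hK, hKψ⟩ := (isChar_of_mem_Irr hψ.1).exists_ker
  have h1 : K ⊓ f.ker = ⊥ := by
    refine (E.minimal _ inferInstance inf_le_right).resolve_right fun h => hψ.2 ?_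
    rw [← hKψ]
    exact SetLike.coe_subset_coe.2 (inf_eq_right.1 h)
  rcases le_ker_or_sup_eq_top E.surj E.simple K with h | h
  · rw [← hKψ, ← h1, inf_eq_left.2 h]
  · exact (E.not_complement K h1 h).elim

lemma cod_mul_charDeg_irrNot (E : Extension f d₀ σ χ g) {ψ : G → ℂ} (hψ : ψ ∈ irrNot f.ker) :
    cod G ψ * charDeg G ψ = Nat.card Q * Nat.card f.ker := by
  rw [cod_mul_charDeg (mem_irrNot.1 hψ).1 (E.kerSet_eq_bot hψ), Subgroup.index_bot,
    ← index_ker E.surj, Subgroup.index_mul_card]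

lemma cod_eq_cod_of_charDeg_eq (E : Extension f d₀ σ χ g) {ψ₁ ψ₂ : G → ℂ}
    (h₁ : ψ₁ ∈ irrNot f.ker) (h₂ : ψ₂ ∈ irrNot f.ker) (h : charDeg G ψ₁ = charDeg G ψ₂) :
    cod G ψ₁ = cod G ψ₂ := by
  have h3 := E.cod_mul_charDeg_irrNot h₁
  rw [← E.cod_mul_charDeg_irrNot h₂, h] at h3
  exact Nat.eq_of_mul_eq_mul_right (charDeg_pos (mem_irrNot.1 h₂).1) h3

lemma charDeg_eq_of_cod_eq (E : Extension f d₀ σ χ g) {ψ : G → ℂ} (hψ : ψ ∈ irrNot f.ker)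
    (h : cod G ψ = d₀) : charDeg G ψ = charDeg G χ * Nat.card f.ker := by
  have := E.finite
  have h3 := E.cod_mul_charDeg_irrNot hψ
  have h4 := E.cod_mul
  rw [h, ← h4, mul_assoc] at h3
  refine Nat.eq_of_mul_eq_mul_left (Nat.pos_of_ne_zero fun h0 => ?_) h3
  rw [h0, zero_mul] at h4
  exact Nat.card_pos.ne h4

lemma two_mul_sq_le (E : Extension f d₀ σ χ g) {ψ₁ ψ₂ : G → ℂ} (h₁ : ψ₁ ∈ irrNot f.ker)
    (h₂ : ψ₂ ∈ irrNot f.ker) (h : charDeg G ψ₁ = charDeg G ψ₂) (hne : ψ₁ ≠ ψ₂) :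
    2 * (charDeg G χ * Nat.card f.ker) ^ 2 ≤ Nat.card Q * (Nat.card f.ker - 1) := by
  classical
  have h3 : ∑ ψ ∈ {ψ₁, ψ₂}, charDeg G ψ ^ 2 ≤ ∑ ψ ∈ irrNot f.ker, charDeg G ψ ^ 2 :=
    Finset.sum_le_sum_of_subset (by
      intro φ hφ
      rcases Finset.mem_insert.1 hφ with rfl | h
      · exact h₁
      · rwa [Finset.mem_singleton.1 h])
  rw [Finset.sum_pair hne, ← h, E.charDeg_eq_of_cod_eq h₁ (E.cod_eq _ (mem_irrNot.1 h₁).1 _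
    (mem_irrNot.1 h₂).1 (E.cod_eq_cod_of_charDeg_eq h₁ h₂ h) hne), sum_irrNot_sq,
    index_ker E.surj] at h3
  omega

/-- A group whose centralizer of the kernel is not contained in the kernel is a central
extension. -/
lemma ker_le_center (E : Extension f d₀ σ χ g)
    (hC : ¬ Subgroup.centralizer (f.ker : Set G) ≤ f.ker) : f.ker ≤ Subgroup.center G := by
  have htop := (le_ker_or_sup_eq_top E.surj E.simple _).resolve_left hC
  rcases E.minimal (Subgroup.centralizer (f.ker : Set G) ⊓ f.ker) inferInstance inf_le_right
    with h | h
  · exact (E.not_complement _ h htop).elim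
  · rw [sup_eq_left.2 (inf_eq_right.1 h)] at htop
    exact Subgroup.centralizer_eq_top_iff_subset.1 htop

lemma card_ker_prime (E : Extension f d₀ σ χ g) (hcen : f.ker ≤ Subgroup.center G) :
    (Nat.card f.ker).Prime := by
  have h1 : Nat.card f.ker ≠ 1 := fun h => E.ne_bot (Subgroup.card_eq_one.1 h)
  obtain ⟨p, hp, hpd⟩ := Nat.exists_prime_and_dvd h1
  have := Fact.mk hp
  obtain ⟨z, hz⟩ := exists_prime_orderOf_dvd_card' p hpd
  have hz' : orderOf (z : G) = p := by rw [Subgroup.orderOf_coe, hz]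
  have hle : Subgroup.zpowers (z : G) ≤ f.ker := Subgroup.zpowers_le.2 z.2
  have hnorm : (Subgroup.zpowers (z : G)).Normal := ⟨fun x hx y => by
    have h2 := Subgroup.mem_center_iff.1 (hcen (hle hx)) y
    rwa [h2, mul_inv_cancel_right]⟩
  rcases E.minimal _ hnorm hle with h | h
  · rw [Subgroup.zpowers_eq_bot, ← orderOf_eq_one_iff, hz'] at h
    exact absurd h hp.ne_one
  · rw [← h, Nat.card_zpowers, hz']
    exact hp

/-- In a central extension with kernel of odd order, the faithful characters are not real. -/
lemma cod_eq_of_two_lt (E : Extension f d₀ σ χ g) (hcen : f.ker ≤ Subgroup.center G)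
    (h2 : Nat.card f.ker ≠ 2) {ψ : G → ℂ} (hψ : ψ ∈ irrNot f.ker) : cod G ψ = d₀ := by
  have := Fact.mk (E.card_ker_prime hcen)
  obtain ⟨z, hz⟩ := exists_prime_orderOf_dvd_card' (Nat.card f.ker) (dvd_refl (Nat.card f.ker))
  have hz' : orderOf (z : G) = Nat.card f.ker := by rw [Subgroup.orderOf_coe, hz]
  have hI := (mem_irrNot.1 hψ).1
  have hc := isChar_of_mem_Irr hI
  refine E.cod_eq_of_map_ne hI (starRingEnd ℂ) (x := z) fun h => ?_
  rw [hc.conj_apply] at h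
  have hk := E.kerSet_eq_bot hψ
  obtain ⟨n, ρ, rfl⟩ := hc.exists_representation
  have hS (x : G) (hx : x ∈ f.ker) : ∃ c : ℂ, ρ x = c • 1 := by
    refine exists_eq_smul_one hI _ fun y => ?_
    rw [← map_mul, ← map_mul, Subgroup.mem_center_iff.1 (hcen hx) y]
  obtain ⟨c, hc'⟩ := hS z z.2
  obtain ⟨c₁, hc₁⟩ := hS (z : G)⁻¹ (f.ker.inv_mem z.2)
  have h0 := apply_one_ne_zero hI
  simp only [Representation.character, map_one] at h h0
  rw [hc', hc₁, map_smul, map_smul, smul_eq_mul, smul_eq_mul] at h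
  have h3 : ρ (z : G)⁻¹ = ρ z := by rw [hc', hc₁, mul_right_cancel₀ h0 h]
  have h4 : (z : G) ^ 2 ∈ kerSet G ρ.character := by
    rw [mem_kerSet_iff, pow_two, map_mul]
    nth_rw 1 [← h3]
    rw [← map_mul, inv_mul_cancel, map_one]
  rw [← hk, SetLike.mem_coe, Subgroup.mem_bot] at h4
  have h5 := orderOf_dvd_of_pow_eq_one h4
  rw [hz'] at h5
  exact h2 ((Nat.prime_dvd_prime_iff_eq (E.card_ker_prime hcen) Nat.prime_two).1 h5)

lemma sq_card_ker_dvd (E : Extension f d₀ σ χ g) (hcen : f.ker ≤ Subgroup.center G)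
    (h2 : Nat.card f.ker ≠ 2) : Nat.card f.ker ^ 2 ∣ Nat.card Q := by
  have hp := E.card_ker_prime hcen
  have h1 := sum_irrNot_sq f.ker
  rw [Finset.sum_congr rfl fun ψ hψ => by
    rw [E.charDeg_eq_of_cod_eq hψ (E.cod_eq_of_two_lt hcen h2 hψ)], Finset.sum_const,
    index_ker E.surj, smul_eq_mul] at h1
  have h3 : Nat.card f.ker ^ 2 ∣ Nat.card Q * (Nat.card f.ker - 1) :=
    ⟨(irrNot f.ker).card * charDeg G χ ^ 2, by rw [← h1]; ring⟩
  refine Nat.Coprime.dvd_of_dvd_mul_right (Nat.Coprime.pow_left 2 ?_) h3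
  refine (hp.coprime_iff_not_dvd).2 fun h => ?_
  have h4 := Nat.le_of_dvd (by have := hp.two_le; omega) h
  have := hp.two_le
  omega

end Extension
/-- The numerical conditions on the order `h` of the quotient, a prime `r` dividing it, and a
lower bound `s` for the character degrees. -/
structure Numerics (r h k s : ℕ) : Prop where
  odd : Odd r
  mod_eq : k * 4 % r = 1
  inj : ∀ i j : Fin s, 4 ^ (i : ℕ) ≡ 4 ^ (j : ℕ) [MOD r] → i = j
  sq_dvd : ∀ p, p.Prime → p ^ 2 ∣ h → p = 2
  faithful : ∀ a m, s ≤ a → r + 1 ≤ m → 2 * (a * m) ^ 2 ≤ h * (m - 1) → m = r + 1 ∧ ¬ r ∣ a * m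
  central : ∀ (a n : ℕ) (D : Finset ℕ), s ≤ a → 2 ≤ n → (∀ d ∈ D, s ≤ d) → a * 2 ∉ D →
    n * (a * 2) ^ 2 + ∑ d ∈ D, d ^ 2 ≠ h

namespace Extension

variable {G Q : Type} [Group G] [Group Q] {f : G →* Q} [Fintype G]
variable {d₀ : ℕ} {σ : ℂ →+* ℂ} {χ : G → ℂ} {g y : G} {r h k s : ℕ} [hr : Fact r.Prime]

lemma le_charDeg (E : Extension f d₀ σ χ g) (hN : Numerics r h k s) (hg : orderOf (f g) = r)
    (hy : f y * f g * (f y)⁻¹ = f g ^ k) : s ≤ charDeg G χ := by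
  refine (isChar_of_mem_Irr (mem_irrOver.1 E.mem).1).le_charDeg hr.out hN.mod_eq hN.inj (x := g)
    (y := y) ?_ ?_ ?_
  · rw [← E.kerSet_eq, SetLike.mem_coe, MonoidHom.mem_ker, map_pow, ← hg, pow_orderOf_eq_one]
  · rw [← E.kerSet_eq, SetLike.mem_coe, MonoidHom.mem_ker, ← orderOf_eq_one_iff, hg]
    exact hr.out.ne_one
  · rw [← E.kerSet_eq, SetLike.mem_coe, MonoidHom.mem_ker]
    simp only [map_mul, map_inv, map_pow]
    rw [hy, inv_mul_cancel]

/-- In a central extension by a group of order two, an element of odd prime order of the quotient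
lifts to an element of the same order, so the degree bound holds for faithful characters. -/
lemma le_charDeg_of_central (E : Extension f d₀ σ χ g) (hN : Numerics r h k s)
    (hg : orderOf (f g) = r) (hy : f y * f g * (f y)⁻¹ = f g ^ k)
    (hcen : f.ker ≤ Subgroup.center G) (h2 : Nat.card f.ker = 2) {ψ : G → ℂ}
    (hψ : ψ ∈ irrNot f.ker) : s ≤ charDeg G ψ := by
  obtain ⟨t, ht⟩ := hN.odd
  have hsq {z : G} (hz : z ∈ f.ker) : z ^ (r + 1) = 1 := by
    have h1 : z ^ 2 = 1 := by
      rw [← h2]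
      exact congrArg Subtype.val (pow_card_eq_one' (x := (⟨z, hz⟩ : f.ker)))
    rw [ht, show 2 * t + 1 + 1 = 2 * (t + 1) by ring, pow_mul, h1, one_pow]
  refine (isChar_of_mem_Irr (mem_irrNot.1 hψ).1).le_charDeg hr.out hN.mod_eq hN.inj
    (x := g ^ (r + 1)) (y := y) ?_ ?_ ?_
  · rw [← E.kerSet_eq_bot hψ, SetLike.mem_coe, Subgroup.mem_bot, ← pow_mul, mul_comm, pow_mul]
    exact hsq (by rw [MonoidHom.mem_ker, map_pow, ← hg, pow_orderOf_eq_one])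
  · rw [← E.kerSet_eq_bot hψ, SetLike.mem_coe, Subgroup.mem_bot]
    intro h1
    have h3 := congrArg f h1
    rw [map_pow, map_one, pow_succ, ← hg, pow_orderOf_eq_one, one_mul, ← orderOf_eq_one_iff,
      hg] at h3
    exact hr.out.ne_one h3
  · rw [← E.kerSet_eq_bot hψ, SetLike.mem_coe, Subgroup.mem_bot, inv_mul_eq_one, ← conj_pow]
    have hz : (g ^ k)⁻¹ * (y * g * y⁻¹) ∈ f.ker := by
      rw [MonoidHom.mem_ker]
      simp only [map_mul, map_inv, map_pow]
      rw [hy, inv_mul_cancel]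
    have hcomm : Commute (g ^ k) ((g ^ k)⁻¹ * (y * g * y⁻¹)) :=
      Subgroup.mem_center_iff.1 (hcen hz) _
    rw [← mul_inv_cancel_left (g ^ k) (y * g * y⁻¹), hcomm.mul_pow, hsq hz, mul_one, ← pow_mul,
      ← pow_mul, mul_comm]

/-- The characters that are nontrivial on the kernel of `f` have pairwise distinct degrees. -/
lemma eq_of_charDeg_eq (E : Extension f d₀ σ χ g) (hN : Numerics r (Nat.card Q) k s)
    (hg : orderOf (f g) = r) (hy : f y * f g * (f y)⁻¹ = f g ^ k) {ψ₁ ψ₂ : G → ℂ}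
    (h₁ : ψ₁ ∈ irrNot f.ker) (h₂ : ψ₂ ∈ irrNot f.ker) (heq : charDeg G ψ₁ = charDeg G ψ₂) :
    ψ₁ = ψ₂ := by
  classical
  by_contra hne
  have hs := E.le_charDeg hN hg hy
  have hd {ψ₁ ψ₂ : G → ℂ} (h₁ : ψ₁ ∈ irrNot f.ker) (h₂ : ψ₂ ∈ irrNot f.ker)
      (heq : charDeg G ψ₁ = charDeg G ψ₂) (hne : ψ₁ ≠ ψ₂) :
      charDeg G ψ₁ = charDeg G χ * Nat.card f.ker :=
    E.charDeg_eq_of_cod_eq h₁ (E.cod_eq _ (mem_irrNot.1 h₁).1 _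
      (mem_irrNot.1 h₂).1 (E.cod_eq_cod_of_charDeg_eq h₁ h₂ heq) hne)
  by_cases hC : Subgroup.centralizer (f.ker : Set G) ≤ f.ker
  · obtain ⟨x, i, hx, hx1⟩ := exists_conjNormal_ne_one hg hC
    have hψ := mem_irrNot.1 h₁
    have hc := isChar_of_mem_Irr hψ.1
    obtain ⟨hm, hnd⟩ := hN.faithful _ _ hs (le_card_of_mulAut_ne_one hx hx1)
      (E.two_mul_sq_le h₁ h₂ heq hne)
    refine hnd (dvd_of_sum_eq_zero hx hx1 hm (F := fun n : f.ker => ψ₁ n) ?_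
      (fun n => hc.isIntegral n) ?_ ?_)
    · intro n
      rw [MulAut.conjNormal_apply, hc.conj]
    · have h3 := sum_mul_eq_zero hψ.1 f.ker hψ.2 1
      rw [finsum_eq_sum_of_fintype] at h3
      simpa using h3
    · rw [← hd h₁ h₂ heq hne, hc.charDeg_eq]
      rfl
  · have hcen := E.ker_le_center hC
    by_cases h2 : Nat.card f.ker = 2
    · have h3 := sum_irrNot_sq f.ker
      rw [h2] at hd
      rw [h2, index_ker E.surj, Nat.add_one_sub_one, mul_one, ← Finset.sum_filter_add_sum_filter_not _
        (fun ψ => charDeg G ψ = charDeg G χ * 2), Finset.sum_congr rfl fun ψ hψ => by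
          rw [(Finset.mem_filter.1 hψ).2], Finset.sum_const, smul_eq_mul] at h3
      rw [← Finset.sum_image (s := (irrNot f.ker).filter fun ψ => ¬ charDeg G ψ = charDeg G χ * 2)
        (g := charDeg G) (f := fun d => d ^ 2)] at h3
      · refine hN.central _ _ _ hs ?_ ?_ ?_ h3
        · refine (Finset.card_pair hne).ge.trans (Finset.card_le_card fun φ hφ => ?_)
          rcases Finset.mem_insert.1 hφ with rfl | hφ
          · exact Finset.mem_filter.2 ⟨h₁, hd h₁ h₂ heq hne⟩
          · rw [Finset.mem_singleton.1 hφ]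
            exact Finset.mem_filter.2 ⟨h₂, hd h₂ h₁ heq.symm (Ne.symm hne)⟩
        · intro d hd'
          obtain ⟨φ, hφ, rfl⟩ := Finset.mem_image.1 hd'
          exact E.le_charDeg_of_central hN hg hy hcen h2 (Finset.mem_filter.1 hφ).1
        · intro hd'
          obtain ⟨φ, hφ, hφ'⟩ := Finset.mem_image.1 hd'
          exact (Finset.mem_filter.1 hφ).2 hφ'
      · intro φ₁ hφ₁ φ₂ hφ₂ hφ
        have hφ₁ := Finset.mem_filter.1 hφ₁
        have hφ₂ := Finset.mem_filter.1 hφ₂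
        by_contra hφne
        exact hφ₁.2 (hd hφ₁.1 hφ₂.1 hφ hφne)
    · exact h2 (hN.sq_dvd _ (E.card_ker_prime hcen) (E.sq_card_ker_dvd hcen h2))

end Extension

variable {G Q : Type} [Group G] [Group Q] {f : G →* Q} [Fintype G]

theorem not_isTk'_of_quotientData {r c j k s n : ℕ} [hr : Fact r.Prime]
    (hQ : QuotientData Q r c j k) (hrc : ¬ r ∣ c) (hc : c ∣ 24) (hj : j.Coprime r)
    (hN : Numerics r (r * c) k s) (hf : Function.Surjective f) (hne : f.ker ≠ ⊥)
    (hmin : ∀ N : Subgroup G, N.Normal → N ≤ f.ker → N = ⊥ ∨ N = f.ker) : ¬ IsTk' G n := by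
  intro hT
  obtain ⟨d₀, hd₀⟩ := exists_cod_eq_of_ne hT
  obtain ⟨g', y', hg, hgj, hy, hcent⟩ := hQ.exists_orderOf
  obtain ⟨u, t, hu, hu3, htu, ht2, hucent⟩ := hQ.exists_order_three
  obtain ⟨g, rfl⟩ := hf g'
  obtain ⟨y, rfl⟩ := hf y'
  obtain ⟨σ, hσ⟩ := exists_galois (r := r) hj
  rw [← map_pow] at hgj
  obtain ⟨χ, hχ, hχg⟩ := exists_irrOver_apply_ne f hgj
  have hker : g ^ r ∈ f.ker := by rw [MonoidHom.mem_ker, map_pow, ← hg, pow_orderOf_eq_one]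
  have hχc := isChar_of_mem_Irr (mem_irrOver.1 hχ).1
  have hσχ : σ (χ g) ≠ χ g := by
    rw [hχc.map_apply hr.out.ne_zero hσ ((mem_irrOver.1 hχ).2 hker)]
    exact hχg.symm
  have E : Extension f d₀ σ χ g := ⟨hf, hQ.simple, fun z hz =>
    eq_one_of_forall_commute hQ.simple hu hu3 htu hz, hne, hmin, hd₀, hχ, hσχ⟩
  have hdeg : ∀ ψ₁ ∈ irrNot f.ker, ∀ ψ₂ ∈ irrNot f.ker,
      charDeg G ψ₁ = charDeg G ψ₂ → ψ₁ = ψ₂ := fun ψ₁ h₁ ψ₂ h₂ h =>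
    E.eq_of_charDeg_eq (hQ.card.symm ▸ hN) hg hy h₁ h₂ h
  have hfix : ∀ φ ∈ irrNot f.ker, ∀ x, σ (φ x) = φ x := by
    intro φ hφ x
    have h1 := mem_irrNot.1 hφ
    refine congrFun (hdeg _ (mem_irrNot.2 ⟨map_mem_Irr h1.1 σ, ?_⟩) _ hφ
      ((isChar_of_mem_Irr h1.1).charDeg_map σ)) x
    rw [kerSet_map]
    exact h1.2
  have hconj : ∀ n ∈ f.ker, IsConj g (g * n) := by
    intro n hn
    refine isConj_mul_of_irrNot_eq_zero f.ker (fun ψ hψ m hm => ?_) hn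
    refine apply_eq_zero_of_map_ne f.ker hfix hχ hψ ?_
    rwa [hχc.mul_of_mem_kerSet ((mem_irrOver.1 hχ).2 hm)]
  have hgfix : ∀ n ∈ f.ker, n * g = g * n → n = 1 := fun n hn h =>
    eq_one_of_commute hconj (fun y => hcent (f y)) hn h
  have hgr : g ^ r = 1 := hgfix _ hker (by rw [← pow_succ, ← pow_succ'])
  refine hne (ker_eq_bot hf (fun x hx n hn => ?_) hu hu3 htu ht2 hucent)
  refine isConj_mul_of_irrNot_eq_zero f.ker (fun ψ hψ m hm => ?_) hn
  refine irrNot_apply_eq_zero hf hQ.card hrc hc hg hgr hgfix hdeg hψ ?_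
  rwa [map_mul, MonoidHom.mem_ker.1 hm, mul_one]

section Arithmetic

lemma eq_two_of_sq_dvd {p h b : ℕ} (hp : p.Prime) (hd : p ^ 2 ∣ h) (h0 : h ≠ 0) (hb : h < (b + 1) ^ 2)
    (H : ∀ q ≤ b, 3 ≤ q → ¬ q ^ 2 ∣ h) : p = 2 := by
  by_contra h2
  have h3 := Nat.le_of_dvd (Nat.pos_of_ne_zero h0) hd
  have h4 : p < b + 1 := lt_of_pow_lt_pow_left₀ 2 (Nat.zero_le _) (h3.trans_lt hb)
  exact H p (by omega) (by have := hp.two_le; omega) hd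

lemma sum_sq_ne {s h b : ℕ} (hb : h < (b + 1) ^ 2) (H : ∀ a ≤ b, s ≤ a → ∀ n ≤ h / (a * 2) ^ 2,
      2 ≤ n → ∀ D ∈ ((Finset.Icc s b).erase (a * 2)).powerset,
        n * (a * 2) ^ 2 + ∑ d ∈ D, d ^ 2 ≠ h) {a n : ℕ} {D : Finset ℕ} (hs : 0 < s) (ha : s ≤ a)
    (hn : 2 ≤ n) (hD : ∀ d ∈ D, s ≤ d) (haD : a * 2 ∉ D) :
    n * (a * 2) ^ 2 + ∑ d ∈ D, d ^ 2 ≠ h := by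
  intro heq
  have hlt {x : ℕ} (hx : x ^ 2 ≤ h) : x ≤ b :=
    Nat.lt_succ_iff.1 (lt_of_pow_lt_pow_left₀ 2 (Nat.zero_le _) (hx.trans_lt hb))
  have h1 : n * (a * 2) ^ 2 ≤ h := by omega
  have ha0 : 0 < a := hs.trans_le ha
  refine H a (hlt (by nlinarith)) ha n ((Nat.le_div_iff_mul_le (by positivity)).2 h1) hn D ?_ heq
  refine Finset.mem_powerset.2 fun d hd => Finset.mem_erase.2 ⟨?_, Finset.mem_Icc.2 ⟨hD d hd, ?_⟩⟩
  · rintro rfl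
    exact haD hd
  · have h2 := Finset.single_le_sum (f := fun d => d ^ 2) (fun _ _ => Nat.zero_le _) hd
    exact hlt (by omega)

lemma numerics_five : Numerics 5 (5 * 12) 4 2 where
  odd := by decide
  mod_eq := rfl
  inj := by decide
  sq_dvd p hp h := eq_two_of_sq_dvd (b := 7) hp h (by norm_num) (by norm_num) (by decide)
  faithful a m ha hm h := by
    obtain ⟨m, rfl⟩ : ∃ t, m = t + 6 := ⟨m - 6, by omega⟩
    rw [show m + 6 - 1 = m + 5 by omega] at h
    have h1 : 2 * (2 * (m + 6)) ^ 2 ≤ 5 * 12 * (m + 5) :=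
      le_trans (Nat.mul_le_mul_left 2 (Nat.pow_le_pow_left (Nat.mul_le_mul_right _ ha) 2)) h
    obtain rfl : m = 0 := by
      by_contra h0
      have : 1 ≤ m := by omega
      nlinarith
    have h2 : a < 3 := by
      by_contra h0
      have : 3 ≤ a := by omega
      nlinarith
    obtain rfl : a = 2 := by omega
    decide
  central a n D ha hn hD haD := sum_sq_ne (b := 7) (by norm_num) (by decide +kernel) (by norm_num)
    ha hn hD haD

lemma numerics_seven : Numerics 7 (7 * 24) 2 3 where
  odd := by decide
  mod_eq := rfl
  inj := by decide
  sq_dvd p hp h := eq_two_of_sq_dvd (b := 12) hp h (by norm_num) (by norm_num) (by decide)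
  faithful a m ha hm h := by
    obtain ⟨m, rfl⟩ : ∃ t, m = t + 8 := ⟨m - 8, by omega⟩
    rw [show m + 8 - 1 = m + 7 by omega] at h
    have h1 : 2 * (3 * (m + 8)) ^ 2 ≤ 7 * 24 * (m + 7) :=
      le_trans (Nat.mul_le_mul_left 2 (Nat.pow_le_pow_left (Nat.mul_le_mul_right _ ha) 2)) h
    obtain rfl : m = 0 := by
      by_contra h0
      have : 1 ≤ m := by omega
      nlinarith
    have h2 : a < 4 := by
      by_contra h0
      have : 4 ≤ a := by omega
      nlinarith
    obtain rfl : a = 3 := by omega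
    decide
  central a n D ha hn hD haD := sum_sq_ne (b := 12) (by norm_num) (by decide +kernel) (by norm_num)
    ha hn hD haD

end Arithmetic
end Codegree

/-- If `M` is a minimal normal subgroup of `G` with `G/M ≅ PSL(2,5)` or
`PSL(2,7)`, then `G` is not a `T'_k`-group for any `k ≥ 1`. -/
theorem not_Tk' (G : Type) [Group G] [Fintype G] (M : Subgroup G)
    (hM : M.Normal) (hMne : M ≠ ⊥)
    (hmin : ∀ N : Subgroup G, N.Normal → N ≤ M → N = ⊥ ∨ N = M)
    (hiso : Nonempty ((G ⧸ M) ≃* PSL2 5) ∨ Nonempty ((G ⧸ M) ≃* PSL2 7)) :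
    ¬ ∃ k : ℕ, 1 ≤ k ∧ IsTk' G k := by
  rintro ⟨k, -, hk⟩
  have hker {Q : Type} [Group Q] (e : (G ⧸ M) ≃* Q) :
      (e.toMonoidHom.comp (QuotientGroup.mk' M)).ker = M := by
    rw [← MonoidHom.comap_ker, (MonoidHom.ker_eq_bot_iff e.toMonoidHom).2 e.injective,
      MonoidHom.comap_bot, QuotientGroup.ker_mk']
  have hsurj {Q : Type} [Group Q] (e : (G ⧸ M) ≃* Q) :
      Function.Surjective (e.toMonoidHom.comp (QuotientGroup.mk' M)) :=
    e.surjective.comp (QuotientGroup.mk'_surjective M)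
  rcases hiso with ⟨⟨e⟩⟩ | ⟨⟨e⟩⟩
  · exact Codegree.not_isTk'_of_quotientData Codegree.quotientData_five (by norm_num) (by norm_num) (by norm_num)
      Codegree.numerics_five (hsurj e) ((hker e).symm ▸ hMne) ((hker e).symm ▸ hmin) hk
  · exact Codegree.not_isTk'_of_quotientData Codegree.quotientData_seven (by norm_num) (by norm_num) (by norm_num)
      Codegree.numerics_seven (hsurj e) ((hker e).symm ▸ hMne) ((hker e).symm ▸ hmin) hk
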